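/- Let p ≥ 2 be an integer and α ∈ (1,2). There exists a constant C̃_{p,α} > 0 depending only on p and α such that for all n ≥ 1, the correction matrix R_n^{p,α} = n^{-α} A_n^{p,α} - T_{n+p-2}(f^{p,α}) satisfies ‖R_n^{p,α}‖_2 ≤ C̃_{p,α} and ‖R_n^{p,α}‖_{1,*} ≤ C̃_{p,α}, where ‖·‖_2 is the spectral norm and ‖·‖_{1,*} is the trace norm (the sum of the singular values). -/

import Mathlib

open MeasureTheory

/-- `sin x / x` with value 1 at 0. -/
noncomputable def sincf (x : ℝ) : ℝ := if x = 0 then 1 else Real.sin x / x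

/-- The symbol `f^{p,α}`. -/
noncomputable def fSymbol (p : ℕ) (α : ℝ) (θ : ℝ) : ℝ :=
  ∑' l : ℤ, |θ + 2 * (l : ℝ) * Real.pi| ^ α * sincf (θ / 2 + (l : ℝ) * Real.pi) ^ (p + 1)

/-- Open uniform knot sequence on [0,1]. -/
noncomputable def knot (p n : ℕ) (i : ℕ) : ℝ :=
  if i ≤ p + 1 then 0 else if n + p + 1 ≤ i then 1 else ((i : ℝ) - ((p : ℝ) + 1)) / n

/-- B-splines of degree `k` (Cox–de Boor recurrence) on the above knots. -/
noncomputable def bspline (p n : ℕ) : ℕ → ℕ → ℝ → ℝ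
  | 0, i, x => if knot p n i ≤ x ∧ x < knot p n (i + 1) then 1 else 0
  | (k + 1), i, x =>
      (if knot p n (i + k + 1) = knot p n i then 0
        else (x - knot p n i) / (knot p n (i + k + 1) - knot p n i) * bspline p n k i x)
      + (if knot p n (i + k + 2) = knot p n (i + 1) then 0
        else (knot p n (i + k + 2) - x) / (knot p n (i + k + 2) - knot p n (i + 1))
              * bspline p n k (i + 1) x)

/-- Greville abscissae. -/
noncomputable def greville (p n : ℕ) (i : ℕ) : ℝ :=
  (∑ j ∈ Finset.range p, knot p n (i + 1 + j)) / p

/-- Left Riemann–Liouville fractional derivative on `[0,1]`, `α ∈ (1,2)`. -/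
noncomputable def RLD0x (α : ℝ) (u : ℝ → ℝ) (x : ℝ) : ℝ :=
  (1 / Real.Gamma (2 - α)) *
    deriv (deriv (fun z => ∫ y in (0:ℝ)..z, (z - y) ^ (1 - α) * u y)) x

/-- Right Riemann–Liouville fractional derivative on `[0,1]`, `α ∈ (1,2)`. -/
noncomputable def RLDx1 (α : ℝ) (u : ℝ → ℝ) (x : ℝ) : ℝ :=
  (1 / Real.Gamma (2 - α)) *
    deriv (deriv (fun z => ∫ y in z..(1:ℝ), (y - z) ^ (1 - α) * u y)) x

/-- Collocation matrix `A_n^L`. -/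
noncomputable def ALmat (p n : ℕ) (α : ℝ) : Matrix (Fin (n + p - 2)) (Fin (n + p - 2)) ℝ :=
  Matrix.of fun i j => RLD0x α (bspline p n p ((j : ℕ) + 2)) (greville p n ((i : ℕ) + 2))

/-- Collocation matrix `A_n^R`. -/
noncomputable def ARmat (p n : ℕ) (α : ℝ) : Matrix (Fin (n + p - 2)) (Fin (n + p - 2)) ℝ :=
  Matrix.of fun i j => RLDx1 α (bspline p n p ((j : ℕ) + 2)) (greville p n ((i : ℕ) + 2))

/-- Full collocation matrix `A_n^{p,α}`. -/
noncomputable def Amat (p n : ℕ) (α : ℝ) : Matrix (Fin (n + p - 2)) (Fin (n + p - 2)) ℝ :=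
  (1 / (2 * Real.cos (Real.pi * α / 2))) • (ALmat p n α + ARmat p n α)

/-- Fourier coefficient `g_k = (1/2π) ∫_{-π}^{π} g(θ) e^{-ikθ} dθ`. -/
noncomputable def fourierCoeffSym (g : ℝ → ℝ) (k : ℤ) : ℂ :=
  ((1 / (2 * Real.pi) : ℝ) : ℂ) *
    ∫ θ in (-Real.pi)..Real.pi, (g θ : ℂ) * Complex.exp (-(Complex.I * (k : ℂ) * (θ : ℂ)))

/-- Toeplitz matrix `T_N(g)` (real entries, `g` real and even). -/
noncomputable def toeplitzMat (N : ℕ) (g : ℝ → ℝ) : Matrix (Fin N) (Fin N) ℝ :=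
  Matrix.of fun i j => (fourierCoeffSym g ((i : ℤ) - (j : ℤ))).re

/-- Correction matrix `R_n^{p,α}`. -/
noncomputable def Rmat (p n : ℕ) (α : ℝ) : Matrix (Fin (n + p - 2)) (Fin (n + p - 2)) ℝ :=
  ((n : ℝ) ^ (-α)) • Amat p n α - toeplitzMat (n + p - 2) (fSymbol p α)

/-- Spectral norm (operator 2-norm). -/
noncomputable def matNorm2 {N : ℕ} (A : Matrix (Fin N) (Fin N) ℝ) : ℝ :=
  ‖LinearMap.toContinuousLinearMap (Matrix.toEuclideanLin A)‖

/-- Trace norm: sum of singular values. -/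
noncomputable def matTraceNorm {N : ℕ} (A : Matrix (Fin N) (Fin N) ℝ) : ℝ :=
  ∑ i, Real.sqrt ((Matrix.posSemidef_conjTranspose_mul_self A).1.eigenvalues i)


theorem frob_trace {N : ℕ} (A : Matrix (Fin N) (Fin N) ℝ) :
    ∑ i, (Matrix.posSemidef_conjTranspose_mul_self A).1.eigenvalues i = ∑ i, ∑ j, A i j ^ 2 := by
  have h := (Matrix.posSemidef_conjTranspose_mul_self A).1.trace_eq_sum_eigenvalues
  simp only [RCLike.ofReal_real_eq_id, id] at h
  rw [← h, Finset.sum_comm]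
  simp [Matrix.trace, Matrix.mul_apply, sq]

theorem matTraceNorm_le {N r : ℕ} (A : Matrix (Fin N) (Fin N) ℝ) (hr : A.rank ≤ r) :
    matTraceNorm A ≤ Real.sqrt r * Real.sqrt (∑ i, ∑ j, A i j ^ 2) := by
  set hA := (Matrix.posSemidef_conjTranspose_mul_self A).1 with hAdef
  have hnn : ∀ i, 0 ≤ hA.eigenvalues i :=
    (Matrix.posSemidef_conjTranspose_mul_self A).eigenvalues_nonneg
  have hrk := hA.rank_eq_card_non_zero_eigs
  rw [Matrix.rank_conjTranspose_mul_self, Fintype.card_subtype] at hrk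
  rw [← Real.sqrt_mul (Nat.cast_nonneg r)]
  apply Real.le_sqrt_of_sq_le
  have e : matTraceNorm A = ∑ i ∈ Finset.univ.filter (fun i => hA.eigenvalues i ≠ 0),
      Real.sqrt (hA.eigenvalues i) := by
    unfold matTraceNorm
    rw [Finset.sum_filter]
    refine Finset.sum_congr rfl fun i _ => ?_
    split_ifs with h
    · rfl
    · push Not at h
      rw [h, Real.sqrt_zero]
  rw [e]
  refine (sq_sum_le_card_mul_sum_sq).trans ?_
  rw [← hrk, ← frob_trace]
  refine mul_le_mul (by exact_mod_cast hr) ?_ (Finset.sum_nonneg fun i _ => sq_nonneg _)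
    (Nat.cast_nonneg _)
  calc _ = ∑ i ∈ Finset.univ.filter (fun i => hA.eigenvalues i ≠ 0), hA.eigenvalues i :=
        Finset.sum_congr rfl fun i _ => Real.sq_sqrt (hnn i)
    _ ≤ _ := Finset.sum_le_sum_of_subset_of_nonneg (Finset.filter_subset _ _) fun i _ _ => hnn i

theorem matNorm2_le {N : ℕ} (A : Matrix (Fin N) (Fin N) ℝ) :
    matNorm2 A ≤ Real.sqrt (∑ i, ∑ j, A i j ^ 2) := by
  unfold matNorm2
  refine ContinuousLinearMap.opNorm_le_bound _ (Real.sqrt_nonneg _) fun x => ?_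
  have hn : 0 ≤ ∑ i, ∑ j, (A i j : ℝ) ^ 2 :=
    Finset.sum_nonneg fun i _ => Finset.sum_nonneg fun j _ => sq_nonneg _
  rw [EuclideanSpace.norm_eq, EuclideanSpace.norm_eq]
  refine le_of_le_of_eq ?_ (Real.sqrt_mul hn _)
  apply Real.sqrt_le_sqrt
  refine le_of_le_of_eq ?_ (Finset.sum_mul _ _ _).symm
  refine Finset.sum_le_sum fun i _ => ?_
  simp only [Real.norm_eq_abs, sq_abs]
  have : (LinearMap.toContinuousLinearMap (Matrix.toEuclideanLin A)) x i = ∑ j, A i j * x j := by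
    simp [Matrix.toLpLin_apply, Matrix.mulVec, dotProduct]
  rw [this]
  exact Finset.sum_mul_sq_le_sq_mul_sq _ _ _

theorem rank_le_of_supp {N : ℕ} (A : Matrix (Fin N) (Fin N) ℝ) (S T : Finset (Fin N))
    (h : ∀ i j, i ∉ S → j ∉ T → A i j = 0) : A.rank ≤ S.card + T.card := by
  let dS : Matrix (Fin N) (Fin N) ℝ := Matrix.diagonal fun i => if i ∈ S then 1 else 0
  let dT : Matrix (Fin N) (Fin N) ℝ := Matrix.diagonal fun i => if i ∈ T then 1 else 0
  have e : A = dS * A + (A - dS * A) * dT := by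
    ext i j
    simp only [dS, dT, Matrix.add_apply, Matrix.mul_diagonal, Matrix.sub_apply,
      Matrix.diagonal_mul]
    by_cases hi : i ∈ S <;> by_cases hj : j ∈ T <;> simp [hi, hj, h]
  have hS : dS.rank ≤ S.card := by
    simp only [dS]
    rw [Matrix.rank_diagonal, Fintype.card_subtype]
    simp
  have hT : dT.rank ≤ T.card := by
    simp only [dT]
    rw [Matrix.rank_diagonal, Fintype.card_subtype]
    simp
  calc A.rank = (dS * A + (A - dS * A) * dT).rank := by rw [← e]
    _ ≤ (dS * A).rank + ((A - dS * A) * dT).rank := by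
        unfold Matrix.rank
        rw [Matrix.mulVecLin_add]
        refine le_trans ?_ (Submodule.finrank_add_le_finrank_add_finrank _ _)
        apply Submodule.finrank_mono
        rintro _ ⟨x, rfl⟩
        exact Submodule.add_mem_sup ⟨x, rfl⟩ ⟨x, rfl⟩
    _ ≤ _ := add_le_add ((Matrix.rank_mul_le_left _ _).trans hS)
      ((Matrix.rank_mul_le_right _ _).trans hT)

theorem summable_zz : Summable fun k : ℤ => 1 / (1 + |(k : ℝ)|) ^ 2 := by
  have h : Summable fun k : ℕ => 1 / (1 + (k : ℝ)) ^ 2 := by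
    have := (summable_nat_add_iff 1).2 (Real.summable_one_div_nat_pow (p := 2).2 (by norm_num))
    refine this.congr fun k => ?_
    push_cast
    ring_nf
  apply Summable.of_nat_of_neg
  · simpa using h
  · simpa using h

theorem sum_zz_le {N : ℕ} (i : ℤ) :
    ∑ j : Fin N, 1 / (1 + |((i - (j : ℤ) : ℤ) : ℝ)|) ^ 2 ≤ ∑' k : ℤ, 1 / (1 + |(k : ℝ)|) ^ 2 := by
  have hinj : Function.Injective fun j : Fin N => i - ((j : ℕ) : ℤ) := by
    intro a b h
    simp only at h
    ext
    omega
  have := summable_zz.sum_le_tsum (Finset.univ.map ⟨_, hinj⟩) (fun k _ => by positivity)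
  simpa [Finset.sum_map] using this

theorem abstract_bound (r : ℕ) (K : ℝ) : ∃ C : ℝ, ∀ (N : ℕ) (A : Matrix (Fin N) (Fin N) ℝ)
    (S T : Finset (Fin N)), S.card ≤ r → T.card ≤ r →
    (∀ i j, i ∉ S → j ∉ T → A i j = 0) →
    (∀ i j : Fin N, |A i j| ≤ K / (1 + |(((i : ℤ) - (j : ℤ) : ℤ) : ℝ)|)) →
    matNorm2 A ≤ C ∧ matTraceNorm A ≤ C := by
  set Z := ∑' k : ℤ, 1 / (1 + |(k : ℝ)|) ^ 2 with hZ
  have hZ0 : 0 ≤ Z := tsum_nonneg fun k => by positivity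
  set F := Real.sqrt (2 * r * (K ^ 2 * Z)) with hF
  refine ⟨max F (Real.sqrt ((2 * r : ℕ) : ℝ) * F), fun N A S T hS hT h0 hK => ?_⟩
  have hfr : ∑ i, ∑ j, A i j ^ 2 ≤ 2 * r * (K ^ 2 * Z) := by
    have hsq : ∀ i j : Fin N, A i j ^ 2 ≤ K ^ 2 * (1 / (1 + |(((i : ℤ) - (j : ℤ) : ℤ) : ℝ)|) ^ 2) := by
      intro i j
      have h := pow_le_pow_left₀ (abs_nonneg _) (hK i j) 2
      rw [sq_abs, div_pow] at h
      rw [mul_one_div]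
      exact h
    have hrow : ∀ i : Fin N, ∑ j, A i j ^ 2 ≤ K ^ 2 * Z := fun i => by
      refine (Finset.sum_le_sum fun j _ => hsq i j).trans ?_
      rw [← Finset.mul_sum]
      exact mul_le_mul_of_nonneg_left (sum_zz_le _) (sq_nonneg _)
    have hcol : ∀ j : Fin N, ∑ i, A i j ^ 2 ≤ K ^ 2 * Z := fun j => by
      refine (Finset.sum_le_sum fun i _ => hsq i j).trans ?_
      rw [← Finset.mul_sum]
      refine mul_le_mul_of_nonneg_left (le_trans (le_of_eq ?_) (sum_zz_le (N := N) (j : ℤ))) (sq_nonneg _)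
      refine Finset.sum_congr rfl fun i _ => ?_
      push_cast
      rw [abs_sub_comm]
    have hsplit : ∀ i j, A i j ^ 2 ≤ (if i ∈ S then A i j ^ 2 else 0) + (if j ∈ T then A i j ^ 2 else 0) := by
      intro i j
      have := sq_nonneg (A i j)
      by_cases hi : i ∈ S <;> by_cases hj : j ∈ T <;> simp [hi, hj, h0, this]
    have hKZ : 0 ≤ K ^ 2 * Z := by positivity
    calc ∑ i, ∑ j, A i j ^ 2
        ≤ ∑ i, ∑ j, ((if i ∈ S then A i j ^ 2 else 0) + (if j ∈ T then A i j ^ 2 else 0)) :=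
          Finset.sum_le_sum fun i _ => Finset.sum_le_sum fun j _ => hsplit i j
      _ = (∑ i ∈ S, ∑ j, A i j ^ 2) + ∑ j ∈ T, ∑ i, A i j ^ 2 := by
          simp_rw [Finset.sum_add_distrib]
          congr 1
          · simp
          · rw [Finset.sum_comm]
            simp
      _ ≤ (∑ i ∈ S, K ^ 2 * Z) + ∑ j ∈ T, K ^ 2 * Z :=
          add_le_add (Finset.sum_le_sum fun i _ => hrow i) (Finset.sum_le_sum fun i _ => hcol i)
      _ = (S.card : ℝ) * (K ^ 2 * Z) + (T.card : ℝ) * (K ^ 2 * Z) := by simp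
      _ ≤ (r : ℝ) * (K ^ 2 * Z) + (r : ℝ) * (K ^ 2 * Z) := by gcongr
      _ = _ := by ring
  have hs := Real.sqrt_le_sqrt hfr
  refine ⟨(matNorm2_le A).trans (hs.trans (le_max_left _ _)), ?_⟩
  have hrk : A.rank ≤ 2 * r := (rank_le_of_supp A S T h0).trans (by omega)
  refine (matTraceNorm_le A hrk).trans (le_trans ?_ (le_max_right _ _))
  exact mul_le_mul_of_nonneg_left hs (Real.sqrt_nonneg _)


theorem mellin_aux {β : ℝ} (h0 : 0 < β) (h1 : β < 1) :
    ∫ s in Set.Ioi (0:ℝ), s ^ β * (1 / (1 + s ^ 2)) = Real.pi / (2 * Real.cos (Real.pi * β / 2)) := by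
  let μ := (volume : Measure ℝ).restrict (Set.Ioi 0)
  let G : ℝ → ℝ → ℝ := fun r s => Real.exp (-r) * (s ^ β * Real.exp (-r * s ^ (2:ℝ)))
  have hin : ∀ r : ℝ, 0 < r → ∫ s in Set.Ioi (0:ℝ), G r s =
      (1 / 2 * Real.Gamma ((β + 1) / 2)) * (Real.exp (-r) * r ^ ((1 - β) / 2 - 1)) := by
    intro r hr
    simp only [G]
    rw [integral_const_mul, integral_rpow_mul_exp_neg_mul_rpow (by norm_num) (by linarith) hr]
    rw [show -(β + 1) / 2 = (1 - β) / 2 - 1 by ring]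
    ring
  have hmeas : AEStronglyMeasurable (Function.uncurry G) (μ.prod μ) := by
    apply Measurable.aestronglyMeasurable
    simp only [G, Function.uncurry_def]
    fun_prop
  have hGint : Integrable (Function.uncurry G) (μ.prod μ) := by
    rw [integrable_prod_iff hmeas]
    constructor
    · refine (ae_restrict_mem measurableSet_Ioi).mono fun r hr => ?_
      simp only [Function.uncurry, G]
      exact (integrableOn_rpow_mul_exp_neg_mul_rpow (by linarith) (by norm_num) hr).const_mul _
    · have : IntegrableOn (fun r => (1 / 2 * Real.Gamma ((β + 1) / 2)) *
          (Real.exp (-r) * r ^ ((1 - β) / 2 - 1))) (Set.Ioi 0) :=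
        (Real.GammaIntegral_convergent (by linarith)).const_mul _
      refine this.congr ?_
      refine (ae_restrict_mem measurableSet_Ioi).mono fun r hr => ?_
      simp only
      rw [← hin r hr]
      refine setIntegral_congr_fun measurableSet_Ioi fun s hs => ?_
      have hs' : (0:ℝ) < s := hs
      simp only [Function.uncurry, G]
      rw [Real.norm_of_nonneg (by positivity)]
  have hsw := integral_integral_swap hGint
  have hL : ∫ r, ∫ s, G r s ∂μ ∂μ = Real.pi / (2 * Real.cos (Real.pi * β / 2)) := by
    have e : ∫ r, ∫ s, G r s ∂μ ∂μ = ∫ r in Set.Ioi (0:ℝ), (1 / 2 * Real.Gamma ((β + 1) / 2)) *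
          (Real.exp (-r) * r ^ ((1 - β) / 2 - 1)) :=
      setIntegral_congr_fun measurableSet_Ioi fun r hr => hin r hr
    rw [e, integral_const_mul, ← Real.Gamma_eq_integral (by linarith)]
    have := Real.Gamma_mul_Gamma_one_sub ((β + 1) / 2)
    rw [show 1 - (β + 1) / 2 = (1 - β) / 2 by ring,
      show Real.pi * ((β + 1) / 2) = Real.pi * β / 2 + Real.pi / 2 by ring,
      Real.sin_add_pi_div_two] at this
    rw [mul_assoc, this]
    rw [one_div_mul_eq_div, div_div, mul_comm (2:ℝ)]
  have hR : ∫ s, ∫ r, G r s ∂μ ∂μ = ∫ s in Set.Ioi (0:ℝ), s ^ β * (1 / (1 + s ^ 2)) := by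
    refine setIntegral_congr_fun measurableSet_Ioi fun s hs => ?_
    have e : ∀ r, G r s = s ^ β * Real.exp (-(1 + s ^ 2) * r) := by
      intro r
      simp only [G]
      rw [mul_left_comm, ← Real.exp_add, show (s:ℝ) ^ (2:ℝ) = s ^ 2 by norm_cast]
      ring_nf
    simp only [e]
    rw [integral_const_mul]
    congr 1
    have := integral_exp_mul_Ioi (a := -(1 + s ^ 2)) (by nlinarith [sq_nonneg s]) 0
    rw [this, mul_zero, Real.exp_zero, neg_div_neg_eq]
  rw [← hR, ← hsw, hL]

theorem sin_rpow_integrable {β : ℝ} (h0 : 0 < β) (h1 : β < 1) :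
    IntegrableOn (fun u : ℝ => Real.sin u * u ^ (-1 - β)) (Set.Ioi 0) := by
  rw [← Set.Ioc_union_Ioi_eq_Ioi (zero_le_one (α := ℝ)), integrableOn_union]
  have hm : Measurable (fun u : ℝ => Real.sin u * u ^ (-1 - β)) := by fun_prop
  constructor
  · have : IntegrableOn (fun u : ℝ => u ^ (-β)) (Set.Ioc 0 1) :=
      (intervalIntegral.intervalIntegrable_rpow' (by linarith)).1
    refine Integrable.mono' this hm.aestronglyMeasurable ?_
    refine (ae_restrict_mem measurableSet_Ioc).mono fun u hu => ?_
    have hu0 : 0 < u := hu.1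
    rw [norm_mul, Real.norm_eq_abs, Real.norm_of_nonneg (by positivity)]
    calc |Real.sin u| * u ^ (-1 - β) ≤ |u| * u ^ (-1-β) := 
          mul_le_mul_of_nonneg_right Real.abs_sin_le_abs (by positivity)
      _ = u ^ (-β) := by
          rw [abs_of_pos hu0]
          nth_rewrite 1 [← Real.rpow_one u]
          rw [← Real.rpow_add hu0]
          ring_nf
  · have : IntegrableOn (fun u : ℝ => u ^ (-1 -β)) (Set.Ioi 1) :=
      integrableOn_Ioi_rpow_of_lt (by linarith) one_pos
    refine Integrable.mono' this hm.aestronglyMeasurable ?_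
    refine (ae_restrict_mem measurableSet_Ioi).mono fun u hu => ?_
    have hu0 : 0 < u := lt_trans one_pos hu
    rw [norm_mul, Real.norm_eq_abs, Real.norm_of_nonneg (by positivity)]
    have : 0 < u ^ (-1 - β) := by positivity
    nlinarith [Real.abs_sin_le_one u]

theorem laplace_sin {s : ℝ} (hs : 0 < s) :
    ∫ u in Set.Ioi (0:ℝ), Real.sin u * Real.exp (-(s * u)) = 1 / (1 + s ^ 2) := by
  have h := integral_exp_mul_complex_Ioi (a := -(s:ℂ) + Complex.I) (by simpa using hs) 0
  have hi := integrableOn_exp_mul_complex_Ioi (a := -(s:ℂ) + Complex.I) (by simpa using hs) 0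
  have h2 := congrArg Complex.im h
  rw [show (∫ x in Set.Ioi (0:ℝ), Complex.exp ((-(s:ℂ) + Complex.I) * x)).im =
    ∫ x in Set.Ioi (0:ℝ), (Complex.exp ((-(s:ℂ) + Complex.I) * x)).im from
    (integral_im hi).symm] at h2
  have e : ∀ x : ℝ, (Complex.exp ((-(s:ℂ) + Complex.I) * x)).im =
      Real.sin x * Real.exp (-(s * x)) := by
    intro x
    rw [Complex.exp_im]
    simp [mul_comm]
  simp only [e] at h2
  rw [h2]
  simp [Complex.div_im, Complex.normSq_apply]
  ring

theorem sin_rpow_integral {β : ℝ} (h0 : 0 < β) (h1 : β < 1) :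
    ∫ u in Set.Ioi (0:ℝ), Real.sin u * u ^ (-1 - β) =
      Real.pi / (2 * Real.cos (Real.pi * β / 2)) / Real.Gamma (1 + β) := by
  let μ := (volume : Measure ℝ).restrict (Set.Ioi 0)
  let G : ℝ → ℝ → ℝ := fun u s => Real.sin u * (s ^ β * Real.exp (-(u * s)))
  have hG0 : 0 < Real.Gamma (1 + β) := Real.Gamma_pos_of_pos (by linarith)
  have hb : ∀ u : ℝ, 0 < u → ∫ s in Set.Ioi (0:ℝ), s ^ β * Real.exp (-(u * s)) =
      Real.Gamma (1 + β) * u ^ (-1 - β) := by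
    intro u hu
    have := Real.integral_rpow_mul_exp_neg_mul_Ioi (a := 1 + β) (by linarith) hu
    rw [show 1 + β - 1 = β by ring] at this
    rw [this, one_div, Real.inv_rpow hu.le, ← Real.rpow_neg hu.le, show -(1 + β) = -1 - β by ring,
      mul_comm]
  have hin : ∀ u : ℝ, 0 < u → ∫ s in Set.Ioi (0:ℝ), G u s =
      Real.Gamma (1 + β) * (Real.sin u * u ^ (-1 - β)) := by
    intro u hu
    simp only [G]
    rw [integral_const_mul, hb u hu]
    ring
  have hmeas : AEStronglyMeasurable (Function.uncurry G) (μ.prod μ) := by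
    apply Measurable.aestronglyMeasurable
    simp only [G, Function.uncurry_def]
    fun_prop
  have hGint : Integrable (Function.uncurry G) (μ.prod μ) := by
    rw [integrable_prod_iff hmeas]
    constructor
    · refine (ae_restrict_mem measurableSet_Ioi).mono fun u hu => ?_
      simp only [Function.uncurry, G]
      have := integrableOn_rpow_mul_exp_neg_mul_rpow (p := 1) (s := β) (b := u) (by linarith) (by norm_num) hu
      simp only [Real.rpow_one, neg_mul] at this
      exact this.const_mul _
    · have : IntegrableOn (fun u => Real.Gamma (1 + β) * ‖Real.sin u * u ^ (-1 - β)‖) (Set.Ioi 0) :=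
        (sin_rpow_integrable h0 h1).norm.const_mul _
      refine this.congr ?_
      refine (ae_restrict_mem measurableSet_Ioi).mono fun u hu => ?_
      have hu0 : 0 < u := hu
      simp only
      rw [norm_mul, Real.norm_of_nonneg (show 0 ≤ u ^ (-1 - β) by positivity), mul_left_comm, ← hb u hu,
        ← integral_const_mul]
      refine setIntegral_congr_fun measurableSet_Ioi fun s hs => ?_
      have hs' : (0:ℝ) < s := hs
      simp only [Function.uncurry, G]
      rw [norm_mul, Real.norm_of_nonneg (show 0 ≤ s ^ β * Real.exp (-(u * s)) by positivity)]
  have hsw := integral_integral_swap hGint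
  have hL : ∫ u, ∫ s, G u s ∂μ ∂μ =
      Real.Gamma (1 + β) * ∫ u in Set.Ioi (0:ℝ), Real.sin u * u ^ (-1 - β) := by
    rw [← integral_const_mul]
    exact setIntegral_congr_fun measurableSet_Ioi fun r hr => hin r hr
  have hR : ∫ s, ∫ u, G u s ∂μ ∂μ = ∫ s in Set.Ioi (0:ℝ), s ^ β * (1 / (1 + s ^ 2)) := by
    refine setIntegral_congr_fun measurableSet_Ioi fun s hs => ?_
    simp only [G, mul_left_comm (Real.sin _)]
    rw [integral_const_mul]
    congr 1
    rw [← laplace_sin hs]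
    simp only [mul_comm s]
    rfl
  rw [hL, hR, mellin_aux h0 h1] at hsw
  rw [← hsw]
  field_simp


theorem posPow_hasDerivAt {r : ℝ} (hr : 1 < r) (s : ℝ) :
    HasDerivAt (fun s : ℝ => (max s 0) ^ r) (r * (max s 0) ^ (r - 1)) s := by
  rcases lt_trichotomy s 0 with h | h | h
  · have : (fun s : ℝ => (max s 0) ^ r) =ᶠ[nhds s] fun _ => 0 := by
      filter_upwards [Iio_mem_nhds h] with x hx
      rw [max_eq_right (le_of_lt hx), Real.zero_rpow (by linarith)]
    rw [max_eq_right h.le, Real.zero_rpow (by linarith), mul_zero]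
    exact (hasDerivAt_const s (0:ℝ)).congr_of_eventuallyEq this
  · subst h
    rw [← hasDerivWithinAt_univ, ← Set.Iic_union_Ici (a := (0:ℝ))]
    simp only [max_self]
    rw [Real.zero_rpow (by linarith), mul_zero]
    refine HasDerivWithinAt.union ?_ ?_
    · refine (hasDerivWithinAt_const (0:ℝ) (Set.Iic 0) (0:ℝ)).congr (fun x hx => ?_) ?_
      · rw [max_eq_right hx, Real.zero_rpow (by linarith)]
      · rw [max_self, Real.zero_rpow (by linarith)]
    · have h := (Real.hasDerivAt_rpow_const (x := 0) (p := r) (Or.inr hr.le)).hasDerivWithinAt (s := Set.Ici 0)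
      rw [Real.zero_rpow (by linarith), mul_zero] at h
      refine h.congr (fun x hx => ?_) ?_
      · rw [max_eq_left hx]
      · rw [max_self]
  · have : (fun s : ℝ => (max s 0) ^ r) =ᶠ[nhds s] fun s => s ^ r := by
      filter_upwards [Ioi_mem_nhds h] with x hx
      rw [max_eq_left (le_of_lt hx)]
    rw [max_eq_left h.le]
    exact (Real.hasDerivAt_rpow_const (Or.inl h.ne')).congr_of_eventuallyEq this

theorem posPow_continuous {r : ℝ} (hr : 0 < r) : Continuous (fun s : ℝ => (max s 0) ^ r) :=
  (continuous_id.max continuous_const).rpow_const fun _ => Or.inr hr.le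

noncomputable def sgp (β a : ℝ) : ℝ := (max a 0) ^ β - (max (-a) 0) ^ β

theorem sin_mul_rpow_pos {β : ℝ} (h0 : 0 < β) (h1 : β < 1) {a : ℝ} (ha : 0 < a) :
    IntegrableOn (fun w : ℝ => Real.sin (w * a) * w ^ (-1 - β)) (Set.Ioi 0) ∧
    ∫ w in Set.Ioi (0:ℝ), Real.sin (w * a) * w ^ (-1 - β) =
      a ^ β * (Real.pi / (2 * Real.cos (Real.pi * β / 2)) / Real.Gamma (1 + β)) := by
  let F : ℝ → ℝ := fun u : ℝ => Real.sin u * u ^ (-1 - β)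
  have e : ∀ w ∈ Set.Ioi (0:ℝ), Real.sin (w * a) * w ^ (-1 - β) = a ^ (1 + β) * F (a * w) := by
    intro w hw
    have hw0 : (0:ℝ) < w := hw
    simp only [F]
    rw [Real.mul_rpow ha.le hw0.le, mul_comm w a, mul_left_comm, ← mul_assoc (a ^ (1 + β)),
      ← Real.rpow_add ha]
    simp
  constructor
  · have h := (integrableOn_Ioi_comp_mul_left_iff F 0 ha).2 (by
      rw [mul_zero]; exact sin_rpow_integrable h0 h1)
    exact (integrableOn_congr_fun e measurableSet_Ioi).2 (h.const_mul _)
  · rw [setIntegral_congr_fun measurableSet_Ioi e, integral_const_mul,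
      integral_comp_mul_left_Ioi F 0 ha, mul_zero]
    simp only [F, smul_eq_mul]
    rw [sin_rpow_integral h0 h1, ← mul_assoc]
    congr 1
    rw [← Real.rpow_neg_one, ← Real.rpow_add ha]
    ring_nf

theorem sin_mul_rpow {β : ℝ} (h0 : 0 < β) (h1 : β < 1) (a : ℝ) :
    IntegrableOn (fun w : ℝ => Real.sin (w * a) * w ^ (-1 - β)) (Set.Ioi 0) ∧
    ∫ w in Set.Ioi (0:ℝ), Real.sin (w * a) * w ^ (-1 - β) =
      sgp β a * (Real.pi / (2 * Real.cos (Real.pi * β / 2)) / Real.Gamma (1 + β)) := by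
  unfold sgp
  rcases lt_trichotomy a 0 with h | h | h
  · obtain ⟨hi, hv⟩ := sin_mul_rpow_pos h0 h1 (neg_pos.2 h)
    have e : ∀ w : ℝ, Real.sin (w * -a) * w ^ (-1 - β) = -(Real.sin (w * a) * w ^ (-1 - β)) := by
      intro w
      rw [mul_neg, Real.sin_neg, neg_mul]
    simp only [e] at hi hv
    refine ⟨by simpa using hi.neg, ?_⟩
    rw [integral_neg] at hv
    rw [max_eq_right h.le, max_eq_left (by linarith), Real.zero_rpow h0.ne']
    linarith
  · subst h
    simp
  · rw [max_eq_left h.le, max_eq_right (by linarith), Real.zero_rpow h0.ne', sub_zero]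
    exact sin_mul_rpow_pos h0 h1 h

noncomputable def hh (p : ℕ) (α s : ℝ) : ℝ :=
  ((max s 0) ^ ((p:ℝ) - α) + (-1) ^ (p + 1) * (max (-s) 0) ^ ((p:ℝ) - α)) / Real.Gamma (p + 1 - α)

noncomputable def gsym (p : ℕ) (α w : ℝ) : ℝ := |w| ^ α * sincf (w / 2) ^ (p + 1)

noncomputable def Iint (p : ℕ) (α y : ℝ) : ℝ := ∫ w, gsym p α w * Real.cos (w * (y + (p + 1) / 2))

theorem sincf_eq (x : ℝ) : sincf x = Real.sinc x := rfl

theorem gsym_continuous (p : ℕ) {α : ℝ} (h : 0 < α) : Continuous (gsym p α) := by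
  unfold gsym
  simp only [sincf_eq]
  exact (continuous_abs.rpow_const fun _ => Or.inr h.le).mul
    ((Real.continuous_sinc.comp (continuous_id.div_const 2)).pow _)

theorem gsym_integrable {p : ℕ} (hp : 2 ≤ p) {α : ℝ} (h1 : 1 < α) (h2 : α < 2) :
    Integrable (gsym p α) := by
  have hI : Integrable (fun w : ℝ => 27 * (1 + ‖w‖) ^ (-(3 - α))) :=
    (integrable_one_add_norm (by simp; linarith)).const_mul _
  refine hI.mono' (gsym_continuous p (by linarith)).aestronglyMeasurable (ae_of_all _ fun w => ?_)
  unfold gsym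
  rw [sincf_eq, Real.norm_eq_abs, Real.norm_eq_abs, abs_mul, abs_pow,
    abs_of_nonneg (show 0 ≤ |w| ^ α by positivity)]
  set S := |Real.sinc (w / 2)| with hS
  have hS0 : 0 ≤ S := abs_nonneg _
  have hS1 : S ≤ 1 := Real.abs_sinc_le_one _
  have hS2 : |w| * S ≤ 2 := by
    rcases eq_or_ne w 0 with rfl | hw
    · simp
    · rw [hS, Real.sinc_of_ne_zero (by simpa using hw), abs_div, abs_div, abs_two]
      have : 0 < |w| := abs_pos.2 hw
      field_simp
      exact Real.abs_sin_le_one _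
  have hpos : 0 < 1 + |w| := by positivity
  have hS3 : S ≤ 3 / (1 + |w|) := by
    rw [le_div_iff₀ hpos]
    nlinarith
  calc |w| ^ α * S ^ (p + 1) ≤ (1 + |w|) ^ α * S ^ 3 := by
        gcongr ?_ * ?_
        · exact Real.rpow_le_rpow (abs_nonneg _) (by linarith) (by linarith)
        · exact pow_le_pow_of_le_one hS0 hS1 (by omega)
    _ ≤ (1 + |w|) ^ α * (3 / (1 + |w|)) ^ 3 := by gcongr
    _ = 27 * (1 + |w|) ^ (-(3 - α)) := by
        rw [show -(3 - α) = α - 3 by ring, Real.rpow_sub hpos, div_pow,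
          show (1 + |w|) ^ (3:ℝ) = (1 + |w|) ^ 3 by norm_cast]
        ring

theorem gsym_cos_integrable {p : ℕ} (hp : 2 ≤ p) {α : ℝ} (h1 : 1 < α) (h2 : α < 2) (c : ℝ) :
    Integrable (fun w => gsym p α w * Real.cos (w * c)) := by
  refine (gsym_integrable hp h1 h2).norm.mono' ?_ (ae_of_all _ fun w => ?_)
  · exact ((gsym_continuous p (by linarith)).mul (by fun_prop)).aestronglyMeasurable
  · rw [norm_mul, Real.norm_eq_abs (Real.cos _)]
    exact mul_le_of_le_one_right (norm_nonneg _) (Real.abs_cos_le_one _)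


theorem Iint_step {p : ℕ} (hp : 2 ≤ p) {α : ℝ} (h1 : 1 < α) (h2 : α < 2) (y : ℝ) :
    Iint (p + 1) α y = ∫ x in y..(y + 1), Iint p α x := by
  have hcos : ∀ w : ℝ, ∫ x in y..(y + 1), Real.cos (w * (x + (p + 1) / 2)) =
      sincf (w / 2) * Real.cos (w * (y + ((p + 1 : ℕ) + 1) / 2)) := by
    intro w
    rcases eq_or_ne w 0 with rfl | hw
    · simp [sincf]
    · have e := intervalIntegral.integral_comp_mul_add (a := y) (b := y + 1) Real.cos hw (w * ((p + 1) / 2))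
      simp only [← mul_add] at e
      rw [e, integral_cos, sincf_eq, Real.sinc_of_ne_zero (by simpa using hw)]
      set c := w * (y + ((p + 1 : ℕ) + 1) / 2) with hc
      set d := w / 2 with hd
      rw [show w * (y + 1 + (p + 1) / 2) = c + d by rw [hc, hd]; push_cast; ring,
        show w * (y + (p + 1) / 2) = c - d by rw [hc, hd]; push_cast; ring,
        Real.sin_add, Real.sin_sub, show w⁻¹ = 1 / (2 * d) by rw [hd]; field_simp]
      have hd0 : d ≠ 0 := by simpa [hd] using hw
      rw [smul_eq_mul]
      field_simp
      ring
  rw [intervalIntegral.integral_of_le (by linarith)]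
  unfold Iint
  have hint : Integrable (Function.uncurry fun x w => gsym p α w * Real.cos (w * (x + (p + 1) / 2)))
      (((volume : Measure ℝ).restrict (Set.Ioc y (y + 1))).prod volume) := by
    have h := (gsym_integrable hp h1 h2).norm.comp_snd ((volume : Measure ℝ).restrict (Set.Ioc y (y + 1)))
    refine h.mono' ?_ (ae_of_all _ fun z => ?_)
    · have := gsym_continuous p (α := α) (by linarith)
      apply Continuous.aestronglyMeasurable
      simp only [Function.uncurry_def]
      fun_prop
    · simp only [Function.uncurry]
      rw [norm_mul, Real.norm_eq_abs (Real.cos _)]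
      exact mul_le_of_le_one_right (norm_nonneg _) (Real.abs_cos_le_one _)
  rw [integral_integral_swap hint]
  refine integral_congr_ae (ae_of_all _ fun w => ?_)
  simp only
  rw [integral_const_mul, ← intervalIntegral.integral_of_le (by linarith), hcos]
  unfold gsym
  ring

open fwdDiff in
theorem fwdDiff_iter_hasDerivAt {f f' : ℝ → ℝ} (h : ∀ x, HasDerivAt f (f' x) x) (n : ℕ) (x : ℝ) :
    HasDerivAt ((fwdDiff (1:ℝ))^[n] f) ((fwdDiff (1:ℝ))^[n] f' x) x := by
  induction n generalizing x with
  | zero => exact h x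
  | succ n ih =>
    rw [Function.iterate_succ_apply', Function.iterate_succ_apply']
    unfold fwdDiff
    exact ((ih (x + 1)).comp_add_const x 1).sub (ih x)

theorem fwdDiff_iter_continuous {f : ℝ → ℝ} (h : Continuous f) (n : ℕ) :
    Continuous ((fwdDiff (1:ℝ))^[n] f) := by
  induction n with
  | zero => exact h
  | succ n ih =>
    rw [Function.iterate_succ_apply']
    unfold fwdDiff
    fun_prop

theorem hh_continuous {p : ℕ} (hp : 2 ≤ p) {α : ℝ} (h2 : α < 2) : Continuous (hh p α) := by
  have hp' : (2:ℝ) ≤ p := by exact_mod_cast hp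
  have := posPow_continuous (r := (p:ℝ) - α) (by linarith)
  have h' : Continuous fun s : ℝ => (max (-s) 0) ^ ((p:ℝ) - α) := this.comp continuous_neg
  unfold hh
  fun_prop

theorem hh_hasDerivAt {p : ℕ} (hp : 2 ≤ p) {α : ℝ} (h2 : α < 2) (s : ℝ) :
    HasDerivAt (hh (p + 1) α) (hh p α s) s := by
  have hp' : (2:ℝ) ≤ p := by exact_mod_cast hp
  have ha := posPow_hasDerivAt (r := ((p + 1 : ℕ):ℝ) - α) (by push_cast; linarith) s
  have hb := (posPow_hasDerivAt (r := ((p + 1 : ℕ):ℝ) - α) (by push_cast; linarith) (-s)).scomp s (hasDerivAt_neg s)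
  have hc := (ha.add (hb.const_mul ((-1) ^ (p + 1 + 1)))).div_const (Real.Gamma ((p + 1 : ℕ) + 1 - α))
  refine hc.congr_deriv ?_
  unfold hh
  have hG : Real.Gamma ((p + 1 : ℕ) + 1 - α) = (p + 1 - α) * Real.Gamma (p + 1 - α) := by
    rw [← Real.Gamma_add_one (by linarith)]
    push_cast
    ring_nf
  have hG0 : Real.Gamma (p + 1 - α) ≠ 0 := (Real.Gamma_pos_of_pos (by linarith)).ne'
  have hne : (p:ℝ) + 1 - α ≠ 0 := by linarith
  rw [hG, show ((p + 1 : ℕ):ℝ) - α - 1 = p - α by push_cast; ring]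
  push_cast
  simp only [smul_eq_mul]
  field_simp
  ring

theorem Iint_base {α : ℝ} (h1 : 1 < α) (h2 : α < 2) (y : ℝ) :
    Iint 2 α y = (Real.pi / Real.cos (Real.pi * α / 2)) * (fwdDiff (1:ℝ))^[3] (hh 2 α) y := by
  set β := 2 - α with hβ
  set Q := Real.pi / (2 * Real.cos (Real.pi * β / 2)) / Real.Gamma (1 + β) with hQ
  let F : ℝ → ℝ := fun w => gsym 2 α w * Real.cos (w * (y + ((2:ℕ) + 1) / 2))
  have habs : ∀ w, F |w| = F w := by
    intro w
    rcases abs_choice w with h | h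
    · rw [h]
    · rw [h]
      simp only [F, gsym, sincf_eq, abs_neg, neg_mul, Real.cos_neg, neg_div, Real.sinc_neg]
  have e1 : Iint 2 α y = 2 * ∫ w in Set.Ioi (0:ℝ), F w := by
    rw [← integral_comp_abs]
    simp only [habs]
    rfl
  let u : ℝ → ℝ → ℝ := fun a w => Real.sin (w * a) * w ^ (-1 - β)
  have hu := fun a => sin_mul_rpow (β := β) (by linarith) (by linarith) a
  have e2 : ∀ w ∈ Set.Ioi (0:ℝ), F w = - (u (y + 3) w - 3 * u (y + 2) w + 3 * u (y + 1) w - u y w) := by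
    intro w hw
    have hw0 : (0:ℝ) < w := hw
    simp only [F, u, gsym]
    rw [sincf_eq, Real.sinc_of_ne_zero (by positivity), abs_of_pos hw0, show -1 - β = α - 3 by rw [hβ]; ring,
      Real.rpow_sub hw0, show w ^ (3:ℝ) = w ^ 3 by norm_cast]
    set c := w * (y + ((2:ℕ) + 1) / 2) with hc
    set d := w / 2 with hd
    rw [show w * (y + 3) = c + 3 * d by rw [hc, hd]; push_cast; ring,
      show w * (y + 2) = c + d by rw [hc, hd]; push_cast; ring,
      show w * (y + 1) = c - d by rw [hc, hd]; push_cast; ring,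
      show w * y = c - 3 * d by rw [hc, hd]; push_cast; ring]
    rw [Real.sin_add, Real.sin_sub, Real.sin_add, Real.sin_sub, Real.sin_three_mul,
      show w = 2 * d by rw [hd]; ring]
    have hd0 : d ≠ 0 := by positivity
    generalize (2 * d) ^ α = Z
    rw [show (2 + 1 : ℕ) = 3 from rfl, div_pow]
    field_simp
    ring
  have e3 : ∫ w in Set.Ioi (0:ℝ), F w = -(sgp β (y + 3) * Q - 3 * (sgp β (y + 2) * Q) +
      3 * (sgp β (y + 1) * Q) - sgp β y * Q) := by
    rw [setIntegral_congr_fun measurableSet_Ioi e2, integral_neg, integral_sub, integral_add, integral_sub,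
      integral_const_mul, integral_const_mul, (hu _).2, (hu _).2, (hu _).2, (hu _).2]
    · exact (hu _).1
    · exact (hu _).1.const_mul _
    · exact (hu _).1.sub ((hu _).1.const_mul _)
    · exact (hu _).1.const_mul _
    · exact ((hu _).1.sub ((hu _).1.const_mul _)).add ((hu _).1.const_mul _)
    · exact (hu _).1
  have e4 : ∀ s, hh 2 α s = sgp β s / Real.Gamma (1 + β) := by
    intro s
    unfold hh sgp
    rw [show ((2:ℕ):ℝ) - α = β by rw [hβ]; norm_num, show ((2:ℕ):ℝ) + 1 - α = 1 + β by rw [hβ]; push_cast; ring]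
    ring
  have hcos : Real.cos (Real.pi * β / 2) = - Real.cos (Real.pi * α / 2) := by
    rw [hβ, show Real.pi * (2 - α) / 2 = Real.pi - Real.pi * α / 2 by ring, Real.cos_pi_sub]
  rw [e1, e3, hQ, hcos]
  simp only [Function.iterate_succ_apply, Function.iterate_zero, id, fwdDiff, e4]
  rw [show y + 1 + 1 + 1 = y + 3 by ring, show y + 1 + 1 = y + 2 by ring]
  have hc0 : Real.cos (Real.pi * α / 2) ≠ 0 := by
    apply ne_of_lt
    apply Real.cos_neg_of_pi_div_two_lt_of_lt <;> nlinarith [Real.pi_pos]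
  have hG0 : Real.Gamma (1 + β) ≠ 0 := (Real.Gamma_pos_of_pos (by linarith)).ne'
  field_simp
  ring

theorem Iint_eq {p : ℕ} (hp : 2 ≤ p) {α : ℝ} (h1 : 1 < α) (h2 : α < 2) (y : ℝ) :
    Iint p α y = (Real.pi / Real.cos (Real.pi * α / 2)) * (fwdDiff (1:ℝ))^[p + 1] (hh p α) y := by
  induction p, hp using Nat.le_induction generalizing y with
  | base => exact Iint_base h1 h2 y
  | succ p hp ih =>
    rw [Iint_step hp h1 h2]
    simp only [ih]
    rw [intervalIntegral.integral_const_mul]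
    congr 1
    rw [Function.iterate_succ_apply' _ (p + 1)]
    exact intervalIntegral.integral_eq_sub_of_hasDerivAt
      (fun x _ => fwdDiff_iter_hasDerivAt (hh_hasDerivAt hp h2) (p + 1) x)
      ((fwdDiff_iter_continuous (hh_continuous hp h2) _).intervalIntegrable _ _)


theorem period_sum (G : ℝ → ℂ) (hG : Integrable G) :
    ∫ θ in (-Real.pi)..Real.pi, ∑' l : ℤ, G (θ + 2 * (l:ℝ) * Real.pi) = ∫ w, G w := by
  have hpi := Real.pi_pos
  let s : ℤ → Set ℝ := fun l => Set.Ioc (-Real.pi + l • (2 * Real.pi)) (-Real.pi + (l + 1) • (2 * Real.pi))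
  have hsm : ∀ l, MeasurableSet (s l) := fun l => measurableSet_Ioc
  have hsd : Pairwise (Function.onFun Disjoint s) := Set.pairwise_disjoint_Ioc_add_zsmul _ _
  have hsu : ⋃ l, s l = Set.univ := iUnion_Ioc_add_zsmul (by positivity) _
  have key : ∀ (E : Type) [NormedAddCommGroup E] [NormedSpace ℝ E] (H : ℝ → E) (l : ℤ),
      ∫ θ in s l, H θ = ∫ θ in Set.Ioc (-Real.pi) Real.pi, H (θ + 2 * (l:ℝ) * Real.pi) := by
    intro E _ _ H l
    have h0 := (intervalIntegral.integral_of_le (μ := volume)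
      (f := fun θ => H (θ + 2 * (l:ℝ) * Real.pi)) (show -Real.pi ≤ Real.pi by linarith))
    rw [← h0, intervalIntegral.integral_comp_add_right H (2 * (l:ℝ) * Real.pi),
      intervalIntegral.integral_of_le (by linarith)]
    have : s l = Set.Ioc (-Real.pi + 2 * (l:ℝ) * Real.pi) (Real.pi + 2 * (l:ℝ) * Real.pi) := by
      simp only [s, zsmul_eq_mul]
      push_cast
      congr 1 <;> ring
    rw [this]
  have hsum := fun (E : Type) [NormedAddCommGroup E] [NormedSpace ℝ E] (H : ℝ → E)
    (hH : Integrable H) => hasSum_integral_iUnion (μ := volume) (f := H) hsm hsd (by rw [hsu]; exact hH.integrableOn)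
  rw [intervalIntegral.integral_of_le (by linarith), ← integral_tsum_of_summable_integral_norm]
  · have := (hsum ℂ G hG).tsum_eq
    simp only [key] at this
    rw [this, hsu, setIntegral_univ]
  · intro l
    exact (hG.comp_add_right _).integrableOn
  · have := (hsum ℝ _ hG.norm).summable
    simp only [key] at this
    exact this

theorem toeplitz_coeff {p : ℕ} (hp : 2 ≤ p) {α : ℝ} (h1 : 1 < α) (h2 : α < 2) (k : ℤ) :
    (fourierCoeffSym (fSymbol p α) k).re =
      1 / (2 * Real.cos (Real.pi * α / 2)) * (fwdDiff (1:ℝ))^[p + 1] (hh p α) (k - (p + 1) / 2) := by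
  let G : ℝ → ℂ := fun w => (gsym p α w : ℂ) * Complex.exp (-(Complex.I * (k : ℂ) * (w : ℂ)))
  have hre : ∀ w, (G w).re = gsym p α w * Real.cos (w * k) := by
    intro w
    simp only [G]
    rw [Complex.re_ofReal_mul, Complex.exp_re]
    simp [mul_comm]
  have hG : Integrable G := by
    refine (gsym_integrable hp h1 h2).norm.mono' ?_ (ae_of_all _ fun w => ?_)
    · have := gsym_continuous p (α := α) (by linarith)
      apply Continuous.aestronglyMeasurable
      simp only [G]
      fun_prop
    · simp only [G]
      rw [norm_mul, Complex.norm_exp]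
      simp
  have hper : ∀ θ : ℝ, (fSymbol p α θ : ℂ) * Complex.exp (-(Complex.I * (k : ℂ) * (θ : ℂ))) =
      ∑' l : ℤ, G (θ + 2 * (l:ℝ) * Real.pi) := by
    intro θ
    unfold fSymbol
    rw [Complex.ofReal_tsum, ← tsum_mul_right]
    refine tsum_congr fun l => ?_
    simp only [G, gsym]
    congr 1
    · rw [show (θ + 2 * (l:ℝ) * Real.pi) / 2 = θ / 2 + (l : ℝ) * Real.pi by ring]
    · have := Complex.exp_periodic.int_mul (-(k * l)) (-(Complex.I * (k : ℂ) * (θ : ℂ)))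
      rw [← this]
      congr 1
      push_cast
      ring
  unfold fourierCoeffSym
  simp only [hper]
  rw [period_sum G hG, Complex.re_ofReal_mul, show (∫ w, G w).re = ∫ w, (G w).re from (integral_re hG).symm]
  simp only [hre]
  have := Iint_eq hp h1 h2 (k - (p + 1) / 2)
  unfold Iint at this
  simp only [sub_add_cancel] at this
  rw [this]
  have := Real.pi_pos
  field_simp


theorem bspline_shift (p n n' : ℕ) (hn : 0 < n) (hn' : 0 < n') (a : ℝ) (k : ℕ) : ∀ j j' : ℕ,
    (∀ i ≤ k + 1, (n:ℝ) * knot p n (j + i) = n' * knot p n' (j' + i) + a) →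
    ∀ y : ℝ, bspline p n k j (y / n) = bspline p n' k j' ((y - a) / n') := by
  have h1 : (0:ℝ) < n := by exact_mod_cast hn
  have h2 : (0:ℝ) < n' := by exact_mod_cast hn'
  induction k with
  | zero =>
    intro j j' h y
    have e0 := h 0 (by omega)
    have e1 := h 1 (by omega)
    simp only [add_zero] at e0
    unfold bspline
    simp only [le_div_iff₀ h1, div_lt_iff₀ h1, le_div_iff₀ h2, div_lt_iff₀ h2]
    congr 1
    apply propext
    constructor <;> rintro ⟨q1, q2⟩ <;> constructor <;> linarith
  | succ k ih =>
    intro j j' h y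
    have i0 := ih j j' (fun i hi => h i (by omega)) y
    have i1 := ih (j + 1) (j' + 1) (fun i hi => by
      have := h (i + 1) (by omega)
      rw [show j + 1 + i = j + (i + 1) by omega, show j' + 1 + i = j' + (i + 1) by omega]
      exact this) y
    have e0 := h 0 (by omega)
    have e1 := h 1 (by omega)
    have e2 := h (k + 1) (by omega)
    have e3 := h (k + 2) (by omega)
    simp only [add_zero] at e0
    simp only [← add_assoc] at e2 e3
    have c : ∀ u v u' v' : ℝ, n * u = n' * u' + a → n * v = n' * v' + a → (u = v ↔ u' = v') := by
      intro u v u' v' q1 q2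
      constructor
      · intro q; subst q; exact mul_left_cancel₀ h2.ne' (by linarith)
      · intro q; subst q; exact mul_left_cancel₀ h1.ne' (by linarith)
    have d : ∀ u v w u' v' w' : ℝ, n * u = n' * u' + a → n * v = n' * v' + a →
        n * w = n' * w' + a → (u - v) / (w - v) = (u' - v') / (w' - v') := by
      intro u v w u' v' w' q1 q2 q3
      have r1 : n * (u - v) = n' * (u' - v') := by linarith
      have r2 : n * (w - v) = n' * (w' - v') := by linarith
      rw [← mul_div_mul_left _ _ h1.ne', r1, r2, mul_div_mul_left _ _ h2.ne']
    have ey : n * (y / n) = n' * ((y - a) / n') + a := by field_simp; ring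
    unfold bspline
    rw [i0, i1]
    congr 1
    · rw [d _ _ _ _ _ _ ey e0 e2]
      simp only [c _ _ _ _ e2 e0]
    · have d' := d _ _ _ _ _ _ ey e3 e1
      rw [show (knot p n (j + k + 2) - y / n) / (knot p n (j + k + 2) - knot p n (j + 1)) =
        (knot p n' (j' + k + 2) - (y - a) / n') / (knot p n' (j' + k + 2) - knot p n' (j' + 1)) by
        rw [← neg_sub, ← neg_sub (knot p n (j + 1)), neg_div_neg_eq, d', ← neg_div_neg_eq, neg_sub, neg_sub]]
      simp only [c _ _ _ _ e3 e1]

theorem knot_mono (p n : ℕ) (hn : 0 < n) : Monotone (knot p n) := by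
  have h1 : (0:ℝ) < n := by exact_mod_cast hn
  apply monotone_nat_of_le_succ
  intro i
  unfold knot
  push_cast
  split_ifs with a b c d e
  · exact le_rfl
  · norm_num
  · have : (p:ℝ) + 1 ≤ i + 1 := by exact_mod_cast (by omega : p + 1 ≤ i + 1)
    apply div_nonneg _ h1.le; linarith
  · omega
  · exact le_rfl
  · omega
  · omega
  · rw [div_le_one h1]
    have : (i:ℝ) + 1 ≤ n + p + 1 := by exact_mod_cast (by omega : i + 1 ≤ n + p + 1)
    linarith
  · gcongr; linarith

theorem bspline_supp (p n : ℕ) (hn : 0 < n) (k : ℕ) : ∀ j x,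
    (x < knot p n j ∨ knot p n (j + k + 1) ≤ x) → bspline p n k j x = 0 := by
  induction k with
  | zero =>
    intro j x h
    unfold bspline
    rw [if_neg]
    rintro ⟨a, b⟩
    rcases h with h | h
    · linarith
    · exact absurd b (not_lt.mpr h)
  | succ k ih =>
    intro j x h
    have m := knot_mono p n hn
    have i1 := ih j x (h.imp id (fun h => le_trans (m (by omega)) h))
    have i2 := ih (j + 1) x (h.imp (fun h => lt_of_lt_of_le h (m (by omega))) (fun h => by
      rwa [show j + 1 + k + 1 = j + (k + 1) + 1 by omega]))
    unfold bspline
    rw [i1, i2]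
    simp

theorem bspline_meas (p n : ℕ) (k : ℕ) : ∀ j, Measurable (bspline p n k j) := by
  induction k with
  | zero =>
    intro j
    have : bspline p n 0 j = fun x => if x ∈ Set.Ico (knot p n j) (knot p n (j+1)) then 1 else 0 := by
      funext x; unfold bspline; rfl
    rw [this]
    exact Measurable.ite measurableSet_Ico measurable_const measurable_const
  | succ k ih =>
    intro j
    have i1 := ih j
    have i2 := ih (j+1)
    have : bspline p n (k+1) j = fun x => (if knot p n (j + k + 1) = knot p n j then 0
        else (x - knot p n j) / (knot p n (j + k + 1) - knot p n j) * bspline p n k j x)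
      + (if knot p n (j + k + 2) = knot p n (j + 1) then 0
        else (knot p n (j + k + 2) - x) / (knot p n (j + k + 2) - knot p n (j + 1))
              * bspline p n k (j + 1) x) := by
      funext x; rw [bspline]
    rw [this]
    split_ifs <;> fun_prop

theorem bspline_bdd (p n : ℕ) (k : ℕ) : ∀ j, ∃ C, ∀ x ∈ Set.Icc (0:ℝ) 1, |bspline p n k j x| ≤ C := by
  have aux : ∀ (a b : ℝ) (f : ℝ → ℝ), (∃ C, ∀ x ∈ Set.Icc (0:ℝ) 1, |f x| ≤ C) →
      ∃ C, ∀ x ∈ Set.Icc (0:ℝ) 1, |(x - a) / b * f x| ≤ C := by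
    rintro a b f ⟨C, hC⟩
    refine ⟨(1 + |a|) / |b| * C, fun x hx => ?_⟩
    rw [abs_mul, abs_div]
    have : |x - a| ≤ 1 + |a| := by
      refine (abs_sub _ _).trans ?_
      rw [abs_of_nonneg hx.1]; linarith [hx.2]
    have := hC x hx
    gcongr
  have aux2 : ∀ f g : ℝ → ℝ, (∃ C, ∀ x ∈ Set.Icc (0:ℝ) 1, |f x| ≤ C) →
     (∃ C, ∀ x ∈ Set.Icc (0:ℝ) 1, |g x| ≤ C) → (∃ C, ∀ x ∈ Set.Icc (0:ℝ) 1, |f x + g x| ≤ C) := by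
    rintro f g ⟨C, hC⟩ ⟨D, hD⟩
    exact ⟨C + D, fun x hx => (abs_add_le _ _).trans (add_le_add (hC x hx) (hD x hx))⟩
  have auxif : ∀ (P : Prop) [Decidable P] (f : ℝ → ℝ), (∃ C, ∀ x ∈ Set.Icc (0:ℝ) 1, |f x| ≤ C) →
     (∃ C, ∀ x ∈ Set.Icc (0:ℝ) 1, |if P then 0 else f x| ≤ C) := by
    intro P _ f h
    by_cases hP : P
    · exact ⟨0, fun x _ => by simp [hP]⟩
    · simpa [hP] using h
  induction k with
  | zero =>
    intro j
    refine ⟨1, fun x _ => ?_⟩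
    unfold bspline
    split_ifs <;> simp
  | succ k ih =>
    intro j
    simp only [bspline]
    apply aux2
    · exact auxif _ _ (aux _ _ _ (ih j))
    · apply auxif
      obtain ⟨C, hC⟩ := aux (knot p n (j + k + 2)) (knot p n (j + 1) - knot p n (j + k + 2)) _ (ih (j+1))
      refine ⟨C, fun x hx => ?_⟩
      rw [← neg_sub x, ← neg_sub (knot p n (j + 1)), neg_div_neg_eq]
      exact hC x hx

theorem knot_symm (p n : ℕ) (hn : 0 < n) (i i' : ℕ) (h : i + i' = n + 2 * p + 2) :
    knot p n i' = 1 - knot p n i := by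
  have h1 : (0:ℝ) < n := by exact_mod_cast hn
  have : (i':ℝ) = n + 2 * p + 2 - i := by
    have : (i:ℝ) + i' = n + 2 * p + 2 := by exact_mod_cast h
    linarith
  unfold knot
  split_ifs <;> first | omega | simp | skip
  rw [this]; field_simp; ring

theorem bspline_symm (p n : ℕ) (hn : 0 < n) (x : ℝ) (hx : ∀ l, x ≠ knot p n l) (k : ℕ) :
    ∀ j j', j + j' + k + 1 = n + 2 * p + 2 → bspline p n k j (1 - x) = bspline p n k j' x := by
  induction k with
  | zero =>
    intro j j' h
    have e1 := knot_symm p n hn j (j' + 1) (by omega)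
    have e2 := knot_symm p n hn (j + 1) j' (by omega)
    unfold bspline
    congr 1
    apply propext
    have a1 := hx j'
    have a2 := hx (j' + 1)
    constructor
    · rintro ⟨q1, q2⟩
      constructor
      · linarith
      · apply lt_of_le_of_ne _ a2; linarith
    · rintro ⟨q1, q2⟩
      constructor
      · linarith
      · have := lt_of_le_of_ne q1 a1.symm; linarith
  | succ k ih =>
    intro j j' h
    have e1 := knot_symm p n hn j (j' + k + 2) (by omega)
    have e2 := knot_symm p n hn (j + 1) (j' + k + 1) (by omega)
    have e3 := knot_symm p n hn (j + k + 1) (j' + 1) (by omega)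
    have e4 := knot_symm p n hn (j + k + 2) j' (by omega)
    unfold bspline
    rw [ih j (j' + 1) (by omega), ih (j + 1) j' (by omega), e1, e2, e3, e4, add_comm]
    congr 1
    · congr 1
      · apply propext; constructor <;> intro q <;> linarith
      · congr 2 <;> ring
    · congr 1
      · apply propext; constructor <;> intro q <;> linarith
      · congr 2 <;> ring

theorem greville_symm (p n : ℕ) (hp : 0 < p) (hn : 0 < n) (i i' : ℕ) (h : i + i' = n + p + 1) :
    greville p n i' = 1 - greville p n i := by
  have h1 : (0:ℝ) < p := by exact_mod_cast hp
  unfold greville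
  rw [← Finset.sum_range_reflect]
  have : ∀ j ∈ Finset.range p, knot p n (i' + 1 + (p - 1 - j)) = 1 - knot p n (i + 1 + j) := by
    intro j hj
    rw [Finset.mem_range] at hj
    exact knot_symm p n hn _ _ (by omega)
  rw [Finset.sum_congr rfl this]
  simp
  field_simp

/-- truncated power -/
noncomputable def tpow (k : ℕ) (s : ℝ) : ℝ := if 0 ≤ s then s ^ k else 0

theorem tpow_succ (k : ℕ) (s : ℝ) : s * tpow k s = tpow (k+1) s := by
  unfold tpow; split_ifs <;> ring

theorem card_rec (k : ℕ) (F : ℕ → ℝ) (y : ℝ) :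
    y * ∑ m ∈ Finset.range (k + 2), (-1:ℝ)^m * (k+1).choose m * F m +
      (k + 2 - y) * ∑ m ∈ Finset.range (k + 2), (-1:ℝ)^m * (k+1).choose m * F (m + 1) =
    ∑ m ∈ Finset.range (k + 3), (-1:ℝ)^m * (k+2).choose m * ((y - m) * F m) := by
  have t1 : ∑ m ∈ Finset.range (k + 2), (-1:ℝ)^m * (k+1).choose m * F m =
     ∑ m ∈ Finset.range (k + 3), (-1:ℝ)^m * (k+1).choose m * F m := by
    rw [Finset.sum_range_succ _ (k+2)]; simp
  rw [t1, Finset.sum_range_succ', Finset.sum_range_succ' _ (k+2), mul_add, add_right_comm, Finset.mul_sum,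
    Finset.mul_sum, ← Finset.sum_add_distrib]
  congr 1
  · refine Finset.sum_congr rfl fun m _ => ?_
    have c1 : ((k+2).choose (m+1) : ℝ) = (k+1).choose m + (k+1).choose (m+1) := by
      exact_mod_cast Nat.choose_succ_succ (k+1) m
    have c2 : ((k:ℝ)+2) * (k+1).choose m = (k+2).choose (m+1) * (m + 1) := by
      exact_mod_cast Nat.add_one_mul_choose_eq (k+1) m
    rw [pow_succ]
    push_cast
    have : (-1:ℝ)^m * F (m+1) * (((k:ℝ)+2) * (k+1).choose m) = (-1:ℝ)^m * F (m+1) * ((k+2).choose (m+1) * (m + 1)) := by rw [c2]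
    rw [c1] at this ⊢
    linear_combination this
  · simp

theorem bspline_card (p n : ℕ) (hn : 0 < n) (k : ℕ) : ∀ (j : ℕ) (b : ℝ),
    (∀ i ≤ k + 1, (n:ℝ) * knot p n (j + i) = b + i) → ∀ y : ℝ,
    bspline p n k j (y / n) = (∑ m ∈ Finset.range (k + 2), (-1:ℝ)^m * (k+1).choose m * tpow k (y - b - m)) / k.factorial := by
  have h1 : (0:ℝ) < n := by exact_mod_cast hn
  induction k with
  | zero =>
    intro j b h y
    have e0 := h 0 (by omega)
    have e1 := h 1 (by omega)
    simp only [add_zero, Nat.cast_zero, Nat.cast_one] at e0 e1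
    unfold bspline
    simp only [le_div_iff₀ h1, div_lt_iff₀ h1, mul_comm _ (n:ℝ), e0, e1]
    simp [Finset.sum_range_succ, tpow]
    split_ifs with q1 q2 q3 q4 q5 q6 <;> first | (exfalso; linarith [q1.1, q1.2]) | (exfalso; apply q1; constructor <;> linarith) | norm_num
  | succ k ih =>
    intro j b h y
    have i0 := ih j b (fun i hi => h i (by omega)) y
    have i1 := ih (j + 1) (b + 1) (fun i hi => by
      have := h (i + 1) (by omega)
      rw [show j + 1 + i = j + (i + 1) by omega, this]; push_cast; ring) y
    have e0 := h 0 (by omega)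
    have e1 := h 1 (by omega)
    have e2 := h (k + 1) (by omega)
    have e3 := h (k + 2) (by omega)
    simp only [add_zero, ← add_assoc, Nat.cast_zero, Nat.cast_one] at e0 e1 e2 e3
    push_cast at e2 e3
    have g : ∀ u b : ℝ, n * u = b → u = b / n := by intro u b h; rw [← h]; field_simp
    have hk : (0:ℝ) < k + 1 := by positivity
    unfold bspline
    rw [i0, i1, g _ _ e0, g _ _ e1, g _ _ e2, g _ _ e3]
    rw [if_neg (by rw [div_left_inj' h1.ne']; intro q; linarith),
      if_neg (by rw [div_left_inj' h1.ne']; intro q; linarith)]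
    have := card_rec k (fun m => tpow k (y - b - m)) (y - b)
    simp only [tpow_succ] at this
    rw [← sub_div, ← sub_div, ← sub_div, ← sub_div, div_div_div_cancel_right₀ h1.ne', div_div_div_cancel_right₀ h1.ne']
    rw [show b + (k+1) - b = (k:ℝ)+1 by ring, show b + (k+2) - (b+1) = (k:ℝ)+1 by ring]
    rw [show k + 1 + 1 = k + 2 by rfl, show k + 2 + 1 = k+3 by rfl, ← this, Nat.factorial_succ]
    have e : ∀ m : ℕ, y - (b + 1) - m = y - b - (m + 1 : ℕ) := by intro m; push_cast; ring
    simp only [e]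
    have : (0:ℝ) < k.factorial := by positivity
    push_cast
    field_simp
    ring


/-- fractional integral -/
noncomputable def fI (α : ℝ) (u : ℝ → ℝ) (z : ℝ) : ℝ := ∫ y in (0:ℝ)..z, (z - y) ^ (1 - α) * u y

theorem RL_eq (α : ℝ) (u : ℝ → ℝ) (x : ℝ) :
  RLD0x α u x = (1 / Real.Gamma (2 - α)) * deriv (deriv (fI α u)) x := rfl

theorem RL_right (α : ℝ) (u : ℝ → ℝ) (x : ℝ) :
    RLDx1 α u x = RLD0x α (fun y => u (1 - y)) (1 - x) := by
  rw [RL_eq]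
  unfold RLDx1
  have h : (fun z => ∫ y in z..(1:ℝ), (y - z) ^ (1 - α) * u y) =
      fun z => fI α (fun y => u (1 - y)) (1 - z) := by
    funext z
    unfold fI
    have := intervalIntegral.integral_comp_sub_left (a := 0) (b := 1 - z) (fun v => (v - z) ^ (1 - α) * u v) 1
    simp only [sub_zero, sub_sub_cancel] at this
    rw [← this]
    refine intervalIntegral.integral_congr fun y _ => ?_
    simp only []
    rw [sub_right_comm]
  rw [h]
  congr 1
  have h2 : deriv (fun z => fI α (fun y => u (1 - y)) (1 - z)) = fun z => - deriv (fI α (fun y => u (1 - y))) (1 - z) := by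
    funext z
    exact deriv_comp_const_sub _ _ _
  rw [h2, deriv.fun_neg, deriv_comp_const_sub (f := deriv (fI α (fun y => u (1 - y)))), neg_neg]

theorem rpow_scale {c : ℝ} (hc : 0 < c) (x r : ℝ) : (c * x) ^ r = c ^ r * x ^ r := by
  rcases le_or_gt 0 x with h | h
  · exact Real.mul_rpow hc.le h
  · rw [Real.rpow_def_of_neg h, Real.rpow_def_of_neg (mul_neg_of_pos_of_neg hc h),
      Real.log_mul hc.ne' h.ne, add_mul, Real.exp_add, Real.rpow_def_of_pos hc]
    ring

theorem RL_scale (α : ℝ) (u : ℝ → ℝ) {c : ℝ} (hc : 0 < c) (t : ℝ) :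
    c ^ (-α) * RLD0x α u (t / c) = RLD0x α (fun y => u (y / c)) t := by
  rw [RL_eq, RL_eq]
  have h : fI α (fun y => u (y / c)) = fun z => (c ^ (2 - α)) * fI α u (c⁻¹ * z) := by
    funext z
    unfold fI
    have := intervalIntegral.integral_comp_div (a := 0) (b := z) (fun v => (z - c * v) ^ (1 - α) * u v) hc.ne'
    rw [show (fun y => (z - y) ^ (1 - α) * u (y / c)) = fun y => (z - c * (y / c)) ^ (1 - α) * u (y / c) by
      funext y; rw [mul_div_cancel₀ _ hc.ne'], this, zero_div,
      show (fun v => (z - c * v) ^ (1 - α) * u v) = fun v => c ^ (1 - α) * ((c⁻¹ * z - v) ^ (1 - α) * u v) by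
        funext v
        rw [← mul_assoc, ← rpow_scale hc]; congr 2; field_simp,
      intervalIntegral.integral_const_mul, smul_eq_mul, ← mul_assoc]
    congr 1
    · rw [show 2 - α = 1 + (1 - α) by ring, Real.rpow_add hc, Real.rpow_one]
    · rw [div_eq_inv_mul]
  have h1 : deriv (fI α (fun y => u (y / c))) = fun z => (c ^ (2 - α) * c⁻¹) * deriv (fI α u) (c⁻¹ * z) := by
    funext z
    rw [h, deriv_const_mul_field']
    simp only [deriv_comp_mul_left]
    simp [mul_assoc]
  rw [h1]
  rw [deriv_const_mul_field']
  simp only [deriv_comp_mul_left c⁻¹ (deriv (fI α u)), smul_eq_mul]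
  rw [div_eq_inv_mul, show 2 - α = 2 + -α by ring, Real.rpow_add hc]
  have : c ^ (2:ℝ) = c^2 := by exact_mod_cast Real.rpow_natCast c 2
  rw [this]
  field_simp

theorem RL_congr_ae (α : ℝ) (u v : ℝ → ℝ) (h : u =ᵐ[volume] v) : RLD0x α u = RLD0x α v := by
  have : fI α u = fI α v := by
    funext z
    apply intervalIntegral.integral_congr_ae
    filter_upwards [h] with y hy _
    rw [hy]
  funext x
  rw [RL_eq, RL_eq, this]

theorem RL_shift (α : ℝ) (ψ : ℝ → ℝ) (hψ : ∀ y < 0, ψ y = 0) {a : ℝ} (ha : 0 ≤ a) (t : ℝ) :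
    RLD0x α (fun y => ψ (y - a)) t = RLD0x α ψ (t - a) := by
  rw [RL_eq, RL_eq]
  have h : fI α (fun y => ψ (y - a)) = fun z => fI α ψ (z - a) := by
    funext z
    unfold fI
    have := intervalIntegral.integral_comp_sub_right (a := 0) (b := z) (fun v => (z - a - v) ^ (1 - α) * ψ v) a
    simp only [sub_sub_sub_cancel_right] at this
    rw [this, zero_sub]
    rcases le_or_gt 0 (z - a) with hz | hz
    · rw [intervalIntegral.integral_of_le (by linarith), intervalIntegral.integral_of_le hz]
      apply setIntegral_eq_of_subset_of_ae_sdiff_eq_zero measurableSet_Ioc.nullMeasurableSet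
      · exact Set.Ioc_subset_Ioc_left (by linarith)
      · have : ∀ᵐ x : ℝ, x ≠ 0 := by simp [ae_iff]
        filter_upwards [this] with x h0 hx
        have : x < 0 := by
          apply lt_of_le_of_ne _ h0
          by_contra hc
          exact hx.2 ⟨by linarith, hx.1.2⟩
        rw [hψ x this, mul_zero]
    · rw [intervalIntegral.integral_symm _ (0:ℝ)]
      have e1 : ∀ b c : ℝ, b ≤ 0 → c ≤ 0 → ∫ y in b..c, (z - a - y) ^ (1 - α) * ψ y = 0 := by
        intro b c hb hc
        rw [← intervalIntegral.integral_zero (a := b) (b := c) (μ := volume) (E := ℝ)]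
        apply intervalIntegral.integral_congr_ae
        have : ∀ᵐ x : ℝ, x ≠ 0 := by simp [ae_iff]
        filter_upwards [this] with x h0 hx
        rw [hψ x (lt_of_le_of_ne (hx.2.trans (max_le hb hc)) h0), mul_zero]
      rw [e1 _ _ (by linarith) hz.le, e1 _ _ hz.le le_rfl, neg_zero]
  have h1 : deriv (fI α (fun y => ψ (y - a))) = fun z => deriv (fI α ψ) (z - a) := by
    funext z
    rw [h, deriv_comp_sub_const]
  rw [h1, deriv_comp_sub_const]

theorem fI_neg (α : ℝ) (ψ : ℝ → ℝ) (hψ : ∀ y < 0, ψ y = 0) {z : ℝ} (hz : z < 0) : fI α ψ z = 0 := by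
  unfold fI
  refine Eq.trans ?_ (intervalIntegral.integral_zero (a := 0) (b := z) (μ := volume) (E := ℝ))
  apply intervalIntegral.integral_congr_ae
  have : ∀ᵐ x : ℝ, x ≠ 0 := by simp [ae_iff]
  filter_upwards [this] with x h0 hx
  rw [hψ x (lt_of_le_of_ne (hx.2.trans (max_le le_rfl hz.le)) h0), mul_zero]

theorem deriv2_congr {f g : ℝ → ℝ} {s : Set ℝ} (hs : IsOpen s) (h : ∀ x ∈ s, f x = g x) {x : ℝ} (hx : x ∈ s) :
    deriv (deriv f) x = deriv (deriv g) x := by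
  have h1 : f =ᶠ[nhds x] g := Filter.eventually_of_mem (hs.mem_nhds hx) h
  exact (Filter.EventuallyEq.deriv h1).deriv_eq

theorem RL_neg (α : ℝ) (ψ : ℝ → ℝ) (hψ : ∀ y < 0, ψ y = 0) {t : ℝ} (ht : t < 0) : RLD0x α ψ t = 0 := by
  rw [RL_eq, deriv2_congr (g := fun _ => 0) isOpen_Iio (fun x hx => fI_neg α ψ hψ hx) ht]
  simp

theorem ker_hasDeriv (ψ : ℝ → ℝ) (N M : ℝ) (hN : 0 ≤ N) (hm : Measurable ψ) (hb : ∀ y ∈ Set.Ioc 0 N, |ψ y| ≤ M)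
    (r : ℝ) (hr : r ≤ 1) (z : ℝ) (hz : N < z) :
    HasDerivAt (fun z => ∫ y in (0:ℝ)..N, (z - y) ^ r * ψ y) (r * ∫ y in (0:ℝ)..N, (z - y) ^ (r - 1) * ψ y) z := by
  rw [← intervalIntegral.integral_const_mul]
  set δ := (z - N) / 2 with hδ
  have hδ0 : 0 < δ := by rw [hδ]; linarith
  have key : ∀ᵐ y : ℝ, y ∈ Set.uIoc 0 N → y ∈ Set.Ioc 0 N := by
    refine Filter.Eventually.of_forall fun y hy => ?_
    rwa [Set.uIoc_of_le hN] at hy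
  have hF := intervalIntegral.hasDerivAt_integral_of_dominated_loc_of_deriv_le (μ := volume) (a := 0) (b := N)
    (F := fun z y => (z - y) ^ r * ψ y) (F' := fun z y => r * ((z - y) ^ (r - 1) * ψ y)) (x₀ := z)
    (s := Metric.ball z δ) (bound := fun _ => |r| * (δ ^ (r-1) * M)) (Metric.ball_mem_nhds _ hδ0) ?_ ?_ ?_ ?_ ?_ ?_
  · exact hF.2
  · refine Filter.Eventually.of_forall fun x => ?_
    apply Measurable.aestronglyMeasurable
    fun_prop
  · rw [intervalIntegrable_iff, Set.uIoc_of_le hN]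
    have hc : ContinuousOn (fun y => (z - y) ^ r) (Set.Icc 0 N) := by
      apply ContinuousOn.rpow_const (by fun_prop)
      intro y hy; left; have := hy.2; linarith
    have := (hc.integrableOn_Icc (μ := volume)).mono_set Set.Ioc_subset_Icc_self
    refine Integrable.mul_bdd (c := M) this hm.aestronglyMeasurable ?_
    filter_upwards [ae_restrict_mem measurableSet_Ioc] with y hy
    exact hb y hy
  · apply Measurable.aestronglyMeasurable
    fun_prop
  · filter_upwards [key] with y hk hy x hx
    have hy := hk hy
    rw [Real.norm_eq_abs, abs_mul, abs_mul]
    have hx' : |x - z| < δ := by simpa [Real.dist_eq] using hx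
    have hp : δ ≤ x - y := by
      have := (abs_lt.mp hx').1
      have := hy.2
      linarith
    have hM := hb y hy
    have : |(x - y) ^ (r - 1)| ≤ δ ^ (r - 1) := by
      rw [abs_of_nonneg (Real.rpow_nonneg (by linarith) _)]
      exact Real.rpow_le_rpow_of_nonpos hδ0 hp (by linarith)
    gcongr
  · exact intervalIntegrable_const
  · filter_upwards [key] with y hk hy x hx
    have hy := hk hy
    have hx' : |x - z| < δ := by simpa [Real.dist_eq] using hx
    have hp : δ ≤ x - y := by
      have := (abs_lt.mp hx').1
      have := hy.2
      linarith
    have := (((hasDerivAt_id x).sub_const y).rpow_const (p := r) (Or.inl (by simp; linarith))).mul_const (ψ y)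
    simp only [id] at this
    refine this.congr_deriv ?_
    ring

theorem RL_decay (α : ℝ) (h1 : 1 < α) (ψ : ℝ → ℝ) (N M : ℝ) (hN : 0 ≤ N) (hm : Measurable ψ)
    (hb : ∀ y ∈ Set.Ioc 0 N, |ψ y| ≤ M) (h0 : ∀ y, N ≤ y → ψ y = 0) (hM : 0 ≤ M) :
    ∃ C, ∀ s, N + 1 ≤ s → |RLD0x α ψ s| ≤ C * (s - N)⁻¹ := by
  refine ⟨|1 / Real.Gamma (2 - α)| * (|1 - α| * (|(1 - α - 1)| * (M * N))), fun s hs => ?_⟩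
  have e0 : ∀ z ∈ Set.Ioi N, fI α ψ z = ∫ y in (0:ℝ)..N, (z - y) ^ (1 - α) * ψ y := by
    intro z hz
    unfold fI
    have hz : N < z := hz
    rw [intervalIntegral.integral_of_le (by linarith), intervalIntegral.integral_of_le hN]
    apply setIntegral_eq_of_subset_of_forall_sdiff_eq_zero measurableSet_Ioc
    · exact Set.Ioc_subset_Ioc_right (by linarith)
    · intro x hx
      have : N ≤ x := by
        by_contra hc
        exact hx.2 ⟨hx.1.1, by linarith⟩
      rw [h0 x this, mul_zero]
  have hs' : N < s := by linarith
  rw [RL_eq, deriv2_congr isOpen_Ioi e0 hs']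
  have e1 : ∀ z ∈ Set.Ioi N, deriv (fun z => ∫ y in (0:ℝ)..N, (z - y) ^ (1 - α) * ψ y) z =
    (1 - α) * ∫ y in (0:ℝ)..N, (z - y) ^ (1 - α - 1) * ψ y := fun z hz =>
      (ker_hasDeriv ψ N M hN hm hb (1 - α) (by linarith) z hz).deriv
  have e2 : deriv (deriv (fun z => ∫ y in (0:ℝ)..N, (z - y) ^ (1 - α) * ψ y)) s =
     (1 - α) * ((1 - α - 1) * ∫ y in (0:ℝ)..N, (s - y) ^ (1 - α - 1 - 1) * ψ y) := by
    rw [Filter.EventuallyEq.deriv_eq (Filter.eventually_of_mem (isOpen_Ioi.mem_nhds hs') e1)]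
    exact ((ker_hasDeriv ψ N M hN hm hb (1 - α - 1) (by linarith) s hs').const_mul _).deriv
  rw [e2, abs_mul, abs_mul, abs_mul]
  have e3 : |∫ y in (0:ℝ)..N, (s - y) ^ (1 - α - 1 - 1) * ψ y| ≤ ((s - N)⁻¹ * M) * |N - 0| := by
    rw [← Real.norm_eq_abs]
    apply intervalIntegral.norm_integral_le_of_norm_le_const
    intro y hy
    rw [Set.uIoc_of_le hN] at hy
    rw [Real.norm_eq_abs, abs_mul]
    have := hb y hy
    have : |(s - y) ^ (1 - α - 1 - 1)| ≤ (s - N)⁻¹ := by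
      have q := hy.2
      rw [abs_of_nonneg (Real.rpow_nonneg (by linarith) _)]
      refine (Real.rpow_le_rpow_of_nonpos (by linarith) (by linarith : s - N ≤ s - y) (by linarith)).trans ?_
      rw [← Real.rpow_neg_one]
      exact Real.rpow_le_rpow_of_exponent_le (by linarith) (by linarith)
    gcongr
  rw [sub_zero, abs_of_nonneg hN] at e3
  calc _ ≤ |1 / Real.Gamma (2 - α)| * (|1 - α| * (|(1 - α - 1)| * (((s - N)⁻¹ * M) * N))) := by gcongr
    _ = _ := by ring


theorem beta_real (p : ℕ) {α : ℝ} (h2 : α < 2) {a : ℝ} (ha : 0 < a) :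
    ∫ y in (0:ℝ)..a, (a - y) ^ (1 - α) * y ^ p =
      a ^ ((p:ℝ) + 2 - α) * (Real.Gamma (2 - α) * p.factorial / Real.Gamma (p + 3 - α)) := by
  have h := Complex.betaIntegral_scaled ((p:ℂ) + 1) ((2:ℂ) - α) ha
  rw [Complex.betaIntegral_eq_Gamma_mul_div _ _ (by simp; positivity) (by simp; linarith)] at h
  have e : ∫ x in (0:ℝ)..a, (x:ℂ) ^ ((p:ℂ) + 1 - 1) * ((a:ℂ) - x) ^ ((2:ℂ) - α - 1) =
      ∫ x in (0:ℝ)..a, (((a - x) ^ (1 - α) * x ^ p : ℝ) : ℂ) := by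
    apply intervalIntegral.integral_congr
    intro x hx
    rw [Set.uIcc_of_le ha.le] at hx
    simp only []
    rw [add_sub_cancel_right, Complex.cpow_natCast, mul_comm]
    push_cast
    congr 1
    rw [Complex.ofReal_cpow (by linarith [hx.2])]
    push_cast
    congr 1
    ring
  rw [e, intervalIntegral.integral_ofReal] at h
  apply Complex.ofReal_injective
  rw [h]
  push_cast
  rw [Complex.ofReal_cpow ha.le, ← Complex.Gamma_ofReal, ← Complex.Gamma_ofReal]
  have e3 : Complex.Gamma ((p:ℂ) + 1) = p.factorial := by exact_mod_cast Complex.Gamma_nat_eq_factorial p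
  rw [e3]
  push_cast
  rw [show (p:ℂ) + 1 + (2 - α) - 1 = p + 2 - α by ring, show (p:ℂ) + 1 + (2 - α) = p + 3 - α by ring,
    mul_comm (p.factorial : ℂ)]

theorem tpow_eq {p : ℕ} (hp : 2 ≤ p) (s : ℝ) : tpow p s = (max s 0) ^ p := by
  unfold tpow
  split_ifs with h
  · rw [max_eq_left h]
  · rw [max_eq_right (by linarith), zero_pow (by omega)]

theorem fI_shift (α : ℝ) (ψ : ℝ → ℝ) (hψ : ∀ y < 0, ψ y = 0) {a : ℝ} (ha : 0 ≤ a) (z : ℝ) :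
    fI α (fun y => ψ (y - a)) z = fI α ψ (z - a) := by
    unfold fI
    have := intervalIntegral.integral_comp_sub_right (a := 0) (b := z) (fun v => (z - a - v) ^ (1 - α) * ψ v) a
    simp only [sub_sub_sub_cancel_right] at this
    rw [this, zero_sub]
    rcases le_or_gt 0 (z - a) with hz | hz
    · rw [intervalIntegral.integral_of_le (by linarith), intervalIntegral.integral_of_le hz]
      apply setIntegral_eq_of_subset_of_ae_sdiff_eq_zero measurableSet_Ioc.nullMeasurableSet
      · exact Set.Ioc_subset_Ioc_left (by linarith)
      · have : ∀ᵐ x : ℝ, x ≠ 0 := by simp [ae_iff]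
        filter_upwards [this] with x h0 hx
        have : x < 0 := by
          apply lt_of_le_of_ne _ h0
          by_contra hc
          exact hx.2 ⟨by linarith, hx.1.2⟩
        rw [hψ x this, mul_zero]
    · rw [intervalIntegral.integral_symm _ (0:ℝ)]
      have e1 : ∀ b c : ℝ, b ≤ 0 → c ≤ 0 → ∫ y in b..c, (z - a - y) ^ (1 - α) * ψ y = 0 := by
        intro b c hb hc
        rw [← intervalIntegral.integral_zero (a := b) (b := c) (μ := volume) (E := ℝ)]
        apply intervalIntegral.integral_congr_ae
        have : ∀ᵐ x : ℝ, x ≠ 0 := by simp [ae_iff]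
        filter_upwards [this] with x h0 hx
        rw [hψ x (lt_of_le_of_ne (hx.2.trans (max_le hb hc)) h0), mul_zero]
      rw [e1 _ _ (by linarith) hz.le, e1 _ _ hz.le le_rfl, neg_zero]

theorem tpow_neg (p : ℕ) : ∀ y < 0, tpow p y = 0 := fun y hy => by
  unfold tpow; rw [if_neg (by linarith)]

theorem fI_tpow {p : ℕ} (hp : 2 ≤ p) {α : ℝ} (h2 : α < 2) (z : ℝ) :
    fI α (tpow p) z = (Real.Gamma (2 - α) * p.factorial / Real.Gamma (p + 3 - α)) *
      (max z 0) ^ ((p:ℝ) + 2 - α) := by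
  have hp' : (2:ℝ) ≤ p := by exact_mod_cast hp
  rcases lt_trichotomy z 0 with h | h | h
  · rw [fI_neg α _ (tpow_neg p) h, max_eq_right h.le, Real.zero_rpow (by linarith), mul_zero]
  · subst h
    rw [max_self, Real.zero_rpow (by linarith), mul_zero]
    simp [fI]
  · rw [max_eq_left h.le, mul_comm, ← beta_real p h2 h]
    unfold fI
    apply intervalIntegral.integral_congr
    intro y hy
    rw [Set.uIcc_of_le h.le] at hy
    simp only [tpow, if_pos hy.1]

theorem RL_card {p : ℕ} (hp : 2 ≤ p) {α : ℝ} (h2 : α < 2) (M : ℕ) (c : ℕ → ℝ) (s : ℝ) :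
    RLD0x α (fun y => ∑ m ∈ Finset.range M, c m * tpow p (y - m)) s =
      ∑ m ∈ Finset.range M, c m * ((p.factorial / Real.Gamma (p + 1 - α)) * (max (s - m) 0) ^ ((p:ℝ) - α)) := by
  have hp' : (2:ℝ) ≤ p := by exact_mod_cast hp
  set K := (Real.Gamma (2 - α) * p.factorial / Real.Gamma (p + 3 - α)) with hK
  have e0 : fI α (fun y => ∑ m ∈ Finset.range M, c m * tpow p (y - m)) =
      fun z : ℝ => ∑ m ∈ Finset.range M, c m * (K * (max (z - m) 0) ^ ((p:ℝ) + 2 - α)) := by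
    funext z
    have : ∀ m : ℕ, K * (max (z - m) 0) ^ ((p:ℝ) + 2 - α) = fI α (fun y => tpow p (y - m)) z := by
      intro m
      rw [fI_shift α _ (tpow_neg p) (Nat.cast_nonneg m), fI_tpow hp h2]
    simp only [this]
    unfold fI
    simp only [Finset.mul_sum]
    rw [intervalIntegral.integral_finsetSum]
    · refine Finset.sum_congr rfl fun m _ => ?_
      rw [← intervalIntegral.integral_const_mul]
      refine intervalIntegral.integral_congr fun y _ => ?_
      ring
    · intro m _
      apply IntervalIntegrable.mul_continuousOn
      · have := (intervalIntegral.intervalIntegrable_rpow' (a := z - 0) (b := z - z) (r := 1 - α) (by linarith)).comp_sub_left z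
        simpa using this
      · simp only [tpow_eq hp]
        fun_prop
  have d : ∀ (r : ℝ) (_ : 1 < r) (L : ℝ), deriv (fun z : ℝ => ∑ m ∈ Finset.range M, c m * (L * (max (z - m) 0) ^ r)) =
     fun z : ℝ => ∑ m ∈ Finset.range M, c m * ((L * r) * (max (z - m) 0) ^ (r - 1)) := by
    intro r hr L
    funext z
    apply HasDerivAt.deriv
    apply HasDerivAt.fun_sum
    intro m _
    have := (((posPow_hasDerivAt hr (z - m)).comp_sub_const z (m:ℝ)).const_mul L).const_mul (c m)
    refine this.congr_deriv ?_
    ring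
  rw [RL_eq, e0, d _ (by linarith), d _ (by linarith)]
  simp only []
  rw [Finset.mul_sum]
  refine Finset.sum_congr rfl fun m _ => ?_
  have g1 : Real.Gamma (p + 3 - α) = (p + 2 - α) * Real.Gamma (p + 2 - α) := by
    rw [← Real.Gamma_add_one (by linarith)]; congr 1; ring
  have g2 : Real.Gamma (p + 2 - α) = (p + 1 - α) * Real.Gamma (p + 1 - α) := by
    rw [← Real.Gamma_add_one (by linarith)]; congr 1; ring
  have q1 : (p:ℝ) + 2 - α - 1 = p + 1 - α := by ring
  have q2 : (p:ℝ) + 1 - α - 1 = p - α := by ring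
  have n0 : Real.Gamma (2 - α) ≠ 0 := (Real.Gamma_pos_of_pos (by linarith)).ne'
  have n1 : Real.Gamma (p + 1 - α) ≠ 0 := (Real.Gamma_pos_of_pos (by linarith)).ne'
  have n2 : (p:ℝ) + 2 - α ≠ 0 := by linarith
  have n3 : (p:ℝ) + 1 - α ≠ 0 := by linarith
  rw [hK, g1, g2, q1, q2]
  field_simp

/-- cardinal value -/
noncomputable def Vc (p : ℕ) (α s : ℝ) : ℝ :=
  (∑ m ∈ Finset.range (p + 2), (-1:ℝ)^m * (p+1).choose m * (max (s - m) 0) ^ ((p:ℝ) - α)) / Real.Gamma (p + 1 - α)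

theorem Vc_sum (p : ℕ) (α s : ℝ) :
    (fwdDiff (1:ℝ))^[p + 1] (hh p α) (s - (p + 1)) = Vc p α s + Vc p α (p + 1 - s) := by
  rw [fwdDiff_iter_eq_sum_shift]
  unfold Vc
  rw [← add_div, ← Finset.sum_range_reflect (fun m : ℕ => (-1:ℝ)^m * (p+1).choose m * (max ((p:ℝ) + 1 - s - m) 0) ^ ((p:ℝ) - α)) ,
    ← Finset.sum_add_distrib, Finset.sum_div, ← Finset.sum_range_reflect]
  refine Finset.sum_congr rfl fun m hm => ?_
  rw [Finset.mem_range] at hm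
  have e1 : p + 1 + 1 - 1 - m = p + 1 - m := by omega
  have e3 : p + 1 - (p + 1 - m) = m := by omega
  have e4 : ((p + 1 - m : ℕ) : ℝ) = p + 1 - m := by rw [Nat.cast_sub (by omega)]; push_cast; ring
  have e5 : (-1:ℝ)^(p + 1 - m) = (-1)^m * (-1)^(p+1) := by
    have : (p + 1) = (p + 1 - m) + m := by omega
    conv_rhs => rw [this]
    rw [pow_add, mul_comm, mul_assoc, ← pow_add, ← two_mul, pow_mul]; simp
  rw [e1, e3, Nat.choose_symm (by omega), e5]
  unfold hh
  rw [nsmul_eq_mul, e4, show s - (p + 1) + (p + 1 - m) * 1 = s - m by ring,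
    show (p:ℝ) + 1 - s - (p + 1 - m) = -(s - m) by ring]
  rw [zsmul_eq_mul]
  push_cast
  ring


/-- scaled entries -/
noncomputable def VV (p n : ℕ) (α : ℝ) (J : ℕ) (t : ℝ) : ℝ := RLD0x α (fun y => bspline p n p J (y / n)) t

theorem nk0 (p n l : ℕ) (h : l ≤ p + 1) : (n:ℝ) * knot p n l = 0 := by
  unfold knot; rw [if_pos h, mul_zero]

theorem nk1 (p n l : ℕ) (hn : 0 < n) (h : p + 1 ≤ l) (h' : l ≤ n + p + 1) :
    (n:ℝ) * knot p n l = l - (p + 1) := by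
  have h1 : (0:ℝ) < n := by exact_mod_cast hn
  unfold knot
  split_ifs with a b
  · have : l = p + 1 := by omega
    subst this; push_cast; ring
  · have : l = n + p + 1 := by omega
    subst this; push_cast; ring
  · field_simp

theorem nk2 (p n l : ℕ) (hn : 0 < n) (h : n + p + 1 ≤ l) : (n:ℝ) * knot p n l = n := by
  unfold knot
  rw [if_neg (by omega), if_pos h, mul_one]

theorem bs_neg (p n : ℕ) (hn : 0 < n) (k J : ℕ) : ∀ y < (0:ℝ), bspline p n k J (y / n) = 0 := by
  intro y hy
  have h1 : (0:ℝ) < n := by exact_mod_cast hn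
  apply bspline_supp p n hn
  left
  have : knot p n 0 = 0 := by simp [knot]
  have := knot_mono p n hn (Nat.zero_le J)
  have : y / n < 0 := div_neg_of_neg_of_pos hy h1
  linarith

theorem knot_le_one (p n : ℕ) (hn : 0 < n) (l : ℕ) : knot p n l ≤ 1 := by
  have h := knot_mono p n hn (Nat.le_add_right l (n + p + 1 + 1))
  have : knot p n (l + (n + p + 1 + 1)) = 1 := by
    unfold knot; rw [if_neg (by omega), if_pos (by omega)]
  linarith

theorem bs_big (p n : ℕ) (hn : 0 < n) (k J : ℕ) : ∀ y, (n:ℝ) ≤ y → bspline p n k J (y / n) = 0 := by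
  intro y hy
  have h1 : (0:ℝ) < n := by exact_mod_cast hn
  apply bspline_supp p n hn
  right
  refine (knot_le_one p n hn _).trans ?_
  rwa [le_div_iff₀ h1, one_mul]

theorem VV_shift (p n n' : ℕ) (α : ℝ) (hn : 0 < n) (hn' : 0 < n') (a : ℝ) (ha : 0 ≤ a) (J J' : ℕ)
    (h : ∀ i ≤ p + 1, (n:ℝ) * knot p n (J + i) = n' * knot p n' (J' + i) + a) (t : ℝ) :
    VV p n α J t = VV p n' α J' (t - a) := by
  unfold VV
  simp only [bspline_shift p n n' hn hn' a p J J' h]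
  exact RL_shift α (fun y => bspline p n' p J' (y / n')) (bs_neg p n' hn' p J') ha t

theorem VV_bound0 (p n : ℕ) (hp : 2 ≤ p) (hn : 0 < n) {α : ℝ} (h1 : 1 < α) (J : ℕ) :
    ∃ C : ℝ, 0 ≤ C ∧ ∀ m : ℤ, |VV p n α J ((m:ℝ) / p)| ≤ C / (1 + |(m:ℝ) / p|) := by
  have hn0 : (0:ℝ) < n := by exact_mod_cast hn
  have hp0 : (0:ℝ) < p := by exact_mod_cast (by omega : 0 < p)
  obtain ⟨M, hM⟩ := bspline_bdd p n p J
  have hM0 : 0 ≤ M := (abs_nonneg _).trans (hM 0 ⟨le_rfl, zero_le_one⟩)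
  obtain ⟨C1, hC1⟩ := RL_decay α h1 (fun y => bspline p n p J (y / n)) n M hn0.le
    ((bspline_meas p n p J).comp (measurable_id.div_const _)) (fun y hy => by
      refine hM _ ⟨div_nonneg hy.1.le hn0.le, ?_⟩
      rw [div_le_one hn0]; exact hy.2) (bs_big p n hn p J) hM0
  set C2 := ∑ m ∈ Finset.range (p * (n + 1) + 1), |VV p n α J ((m:ℝ) / p)| with hC2
  have hC20 : 0 ≤ C2 := Finset.sum_nonneg fun _ _ => abs_nonneg _
  have hC0 : 0 ≤ (|C1| + C2) * (n + 2) := by positivity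
  refine ⟨(|C1| + C2) * (n + 2), hC0, fun m => ?_⟩
  rcases lt_or_ge m 0 with hm | hm
  · have : (m:ℝ) / p < 0 := div_neg_of_neg_of_pos (by exact_mod_cast hm) hp0
    unfold VV
    rw [RL_neg α _ (bs_neg p n hn p J) this, abs_zero]
    positivity
  · lift m to ℕ using hm
    have hm0 : (0:ℝ) ≤ ((m:ℤ):ℝ) / p := by positivity
    rw [abs_of_nonneg hm0, le_div_iff₀ (by positivity)]
    simp only [Int.cast_natCast] at hm0 ⊢
    set s := (m:ℝ) / p with hs
    rcases le_or_gt m (p * (n + 1)) with hle | hgt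
    · have b1 : |VV p n α J s| ≤ C2 :=
        Finset.single_le_sum (f := fun m : ℕ => |VV p n α J ((m:ℝ) / p)|) (fun _ _ => abs_nonneg _)
          (Finset.mem_range.mpr (by omega))
      have b2 : s ≤ n + 1 := by
        rw [hs, div_le_iff₀ hp0, mul_comm]; exact_mod_cast hle
      calc _ ≤ C2 * (n + 2) := mul_le_mul b1 (by linarith) (by linarith) hC20
        _ ≤ _ := by gcongr; linarith [abs_nonneg C1]
    · have b2 : (n:ℝ) + 1 ≤ s := by
        rw [hs, le_div_iff₀ hp0, mul_comm]; exact_mod_cast hgt.le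
      have b1 : |VV p n α J s| ≤ C1 * (s - n)⁻¹ := hC1 s b2
      have b3 : 0 < s - n := by linarith
      have b4 : (s - n)⁻¹ * (1 + s) ≤ n + 2 := by
        rw [inv_mul_le_iff₀ b3]; nlinarith
      calc _ ≤ |C1| * (s - n)⁻¹ * (1 + s) := by
            gcongr; exact b1.trans (by gcongr; exact le_abs_self _)
        _ = |C1| * ((s - n)⁻¹ * (1 + s)) := by ring
        _ ≤ |C1| * (n + 2) := by gcongr
        _ ≤ _ := by gcongr; linarith

theorem dist_change {C K x y : ℝ} (hC : 0 ≤ C) (hK : 0 ≤ K) (h : |x - y| ≤ K) :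
    C / (1 + |x|) ≤ C * (1 + K) / (1 + |y|) := by
  rw [div_le_div_iff₀ (by positivity) (by positivity)]
  have : |y| ≤ |x| + K := by
    have := abs_sub_abs_le_abs_sub y x
    rw [abs_sub_comm] at this
    linarith
  have hx := abs_nonneg x
  rw [mul_assoc]
  gcongr
  nlinarith

theorem VV_bound1 (p : ℕ) (hp : 2 ≤ p) {α : ℝ} (h1 : 1 < α) :
    ∃ C : ℝ, 0 ≤ C ∧ ∀ n, p + 1 ≤ n → ∀ J, J ≤ n + p → ∀ m : ℤ,
      |VV p n α J ((m:ℝ) / p)| ≤ C / (1 + |(m:ℝ) / p - J|) := by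
  have hp0 : (0:ℝ) < p := by exact_mod_cast (by omega : 0 < p)
  choose C hC0 hC using VV_bound0 p (p+1) hp (by omega) h1
  set D := ∑ J ∈ Finset.range (2 * p + 2), C J with hD
  have hD0 : 0 ≤ D := Finset.sum_nonneg fun _ _ => hC0 _
  have hCD : ∀ J ≤ 2 * p + 1, ∀ m : ℤ, |VV p (p+1) α J ((m:ℝ) / p)| ≤ D / (1 + |(m:ℝ) / p|) := by
    intro J hJ m
    refine (hC J m).trans ?_
    gcongr
    exact Finset.single_le_sum (f := C) (fun _ _ => hC0 _) (Finset.mem_range.mpr (by omega))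
  refine ⟨D * (1 + (2 * p + 1)), by positivity, fun n hn J hJ m => ?_⟩
  have key : ∃ (a J' : ℕ), J' ≤ 2 * p + 1 ∧ J = J' + a ∧
      (∀ i ≤ p + 1, (n:ℝ) * knot p n (J + i) = (p + 1 : ℕ) * knot p (p+1) (J' + i) + a) := by
    rcases le_or_gt J p with hJ1 | hJ1
    · refine ⟨0, J, by omega, rfl, fun i hi => ?_⟩
      rcases le_or_gt (J + i) (p + 1) with h | h
      · rw [nk0 _ _ _ h, nk0 _ _ _ h]; simp
      · rw [nk1 _ _ _ (by omega) h.le (by omega), nk1 _ _ _ (by omega) h.le (by omega)]; simp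
    · rcases le_or_gt J n with hJ2 | hJ2
      · refine ⟨J - (p + 1), p + 1, by omega, by omega, fun i hi => ?_⟩
        rw [nk1 _ _ _ (by omega) (by omega) (by omega), nk1 _ _ _ (by omega) (by omega) (by omega),
          Nat.cast_sub (by omega)]
        push_cast; ring
      · refine ⟨n - (p + 1), J - (n - (p + 1)), by omega, by omega, fun i hi => ?_⟩
        rcases le_or_gt (n + p + 1) (J + i) with h | h
        · rw [nk2 _ _ _ (by omega) h, nk2 _ _ _ (by omega) (by omega), Nat.cast_sub (by omega)]
          ring
        · rw [nk1 _ _ _ (by omega) (by omega) (by omega), nk1 _ _ _ (by omega) (by omega) (by omega),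
            show J - (n - (p + 1)) + i = (J + i) - (n - (p + 1)) by omega, Nat.cast_sub (by omega)]
          ring
  obtain ⟨a, J', hJ', hJa, hk⟩ := key
  rw [VV_shift p n (p+1) α (by omega) (by omega) a (Nat.cast_nonneg a) J J' hk]
  have e : (m:ℝ) / p - a = ((m - p * a : ℤ) : ℝ) / p := by push_cast; field_simp
  rw [e]
  refine (hCD J' hJ' _).trans ?_
  rw [← e]
  apply dist_change hD0 (by positivity)
  rw [hJa]
  push_cast
  rw [show (m:ℝ) / p - a - (m / p - (J' + a)) = J' by ring, abs_of_nonneg (by positivity)]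
  exact_mod_cast hJ'

theorem grev_int (p n : ℕ) (hn : 0 < n) (I : ℕ) : ∃ m : ℤ, (n:ℝ) * greville p n I = m / p := by
  have : ∀ l, ∃ m : ℤ, (n:ℝ) * knot p n l = m := by
    intro l
    rcases le_or_gt l (p+1) with h | h
    · exact ⟨0, by rw [nk0 _ _ _ h]; simp⟩
    · rcases le_or_gt (n + p + 1) l with h' | h'
      · exact ⟨n, by rw [nk2 _ _ _ hn h']; simp⟩
      · exact ⟨l - (p + 1), by rw [nk1 _ _ _ hn h.le h'.le]; push_cast; ring⟩
  choose m hm using this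
  refine ⟨∑ j ∈ Finset.range p, m (I + 1 + j), ?_⟩
  unfold greville
  rw [← mul_div_assoc, Finset.mul_sum]
  simp only [hm]
  push_cast
  rfl

theorem grev_near (p n : ℕ) (hp : 0 < p) (hn : 0 < n) (I : ℕ) (hI : I ≤ n + p) :
    |(n:ℝ) * greville p n I - I| ≤ 2 * p + 1 := by
  have hp0 : (0:ℝ) < p := by exact_mod_cast hp
  have : ∀ j ∈ Finset.range p, |(n:ℝ) * knot p n (I + 1 + j) - I| ≤ 2 * p + 1 := by
    intro j hj
    rw [Finset.mem_range] at hj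
    have hj' : (j:ℝ) + 1 ≤ p := by exact_mod_cast hj
    have hj0 : (0:ℝ) ≤ j := by positivity
    have hI0 : (0:ℝ) ≤ I := by positivity
    have hI1 : (I:ℝ) ≤ n + p := by exact_mod_cast hI
    rw [abs_le]
    rcases le_or_gt (I + 1 + j) (p+1) with h | h
    · rw [nk0 _ _ _ h]
      have : (I:ℝ) + 1 + j ≤ p + 1 := by exact_mod_cast h
      constructor <;> linarith
    · rcases le_or_gt (n + p + 1) (I + 1 + j) with h' | h'
      · rw [nk2 _ _ _ hn h']
        have : (n:ℝ) + p + 1 ≤ I + 1 + j := by exact_mod_cast h'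
        constructor <;> linarith
      · rw [nk1 _ _ _ hn h.le h'.le]
        push_cast
        constructor <;> linarith
  unfold greville
  have e : (n:ℝ) * ((∑ j ∈ Finset.range p, knot p n (I + 1 + j)) / p) - I =
      (∑ j ∈ Finset.range p, ((n:ℝ) * knot p n (I + 1 + j) - I)) / p := by
    rw [Finset.sum_sub_distrib, ← Finset.mul_sum]
    simp
    field_simp
  rw [e, abs_div, abs_of_pos hp0, div_le_iff₀ hp0]
  refine (Finset.abs_sum_le_sum_abs _ _).trans ((Finset.sum_le_sum this).trans ?_)
  simp [mul_comm, mul_add]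

theorem VV_entry (p : ℕ) (hp : 2 ≤ p) {α : ℝ} (h1 : 1 < α) :
    ∃ C : ℝ, 0 ≤ C ∧ ∀ n, p + 1 ≤ n → ∀ I J, I ≤ n + p → J ≤ n + p →
      |VV p n α J (n * greville p n I)| ≤ C / (1 + |(I:ℝ) - J|) := by
  obtain ⟨C, hC0, hC⟩ := VV_bound1 p hp h1
  refine ⟨C * (1 + (2 * p + 1)), by positivity, fun n hn I J hI hJ => ?_⟩
  obtain ⟨m, hm⟩ := grev_int p n (by omega) I
  have := hC n hn J hJ m
  rw [← hm] at this
  refine this.trans (dist_change hC0 (by positivity) ?_)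
  rw [sub_sub_sub_cancel_right]
  exact grev_near p n (by omega) (by omega) I hI

theorem VV_card (p n : ℕ) (hp : 2 ≤ p) (hn : 0 < n) {α : ℝ} (h2 : α < 2) (J : ℕ) (hJ : p + 1 ≤ J) (hJ' : J ≤ n) (t : ℝ) :
    VV p n α J t = Vc p α (t - (J - (p + 1))) := by
  have h0 : (0:ℝ) ≤ (J:ℝ) - (p + 1) := by
    have : (p:ℝ) + 1 ≤ J := by exact_mod_cast hJ
    linarith
  have hb := bspline_card p n hn p J ((J:ℝ) - (p + 1)) (fun i hi => by
    rw [nk1 _ _ _ hn (by omega) (by omega)]; push_cast; ring)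
  unfold VV
  have e : (fun y : ℝ => bspline p n p J (y / n)) = fun y => (fun v : ℝ => ∑ m ∈ Finset.range (p + 2),
      ((-1:ℝ)^m * (p+1).choose m / p.factorial) * tpow p (v - m)) (y - ((J:ℝ) - (p + 1))) := by
    funext y
    rw [hb, Finset.sum_div]
    refine Finset.sum_congr rfl fun m _ => ?_
    ring
  rw [e, RL_shift α (fun v : ℝ => ∑ m ∈ Finset.range (p + 2),
      ((-1:ℝ)^m * (p+1).choose m / p.factorial) * tpow p (v - m)) _ h0, RL_card hp h2]
  · unfold Vc
    rw [Finset.sum_div]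
    refine Finset.sum_congr rfl fun m _ => ?_
    have : (0:ℝ) < p.factorial := by positivity
    field_simp
  · intro y hy
    apply Finset.sum_eq_zero
    intro m _
    rw [tpow_neg, mul_zero]
    have : (0:ℝ) ≤ m := by positivity
    linarith

theorem grev_mid (p n : ℕ) (hp : 2 ≤ p) (hn : 0 < n) (I : ℕ) (hI : p ≤ I) (hI' : I ≤ n + 1) :
    (n:ℝ) * greville p n I = I - ((p:ℝ) + 1) / 2 := by
  have hp0 : (0:ℝ) < p := by exact_mod_cast (by omega : 0 < p)
  unfold greville
  rw [← mul_div_assoc, Finset.mul_sum]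
  have : ∀ j ∈ Finset.range p, (n:ℝ) * knot p n (I + 1 + j) = ((I:ℝ) - p) + j := by
    intro j hj
    rw [Finset.mem_range] at hj
    rw [nk1 _ _ _ hn (by omega) (by omega)]
    push_cast
    ring
  rw [Finset.sum_congr rfl this, Finset.sum_add_distrib]
  have g : (∑ j ∈ Finset.range p, (j:ℝ)) * 2 = p * (p - 1) := by
    have := Finset.sum_range_id_mul_two p
    have h : (((∑ i ∈ Finset.range p, i) * 2 : ℕ) : ℝ) = ((p * (p - 1) : ℕ) : ℝ) := by rw [this]
    rw [Nat.cast_mul, Nat.cast_mul, Nat.cast_sub (by omega)] at h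
    push_cast at h
    exact h
  rw [Finset.sum_const, Finset.card_range, nsmul_eq_mul]
  field_simp
  linear_combination g

theorem AL_entry (p n : ℕ) (hn : 0 < n) (α : ℝ) (i j : Fin (n + p - 2)) :
    (n:ℝ) ^ (-α) * ALmat p n α i j = VV p n α (j + 2) (n * greville p n (i + 2)) := by
  have h1 : (0:ℝ) < n := by exact_mod_cast hn
  unfold VV
  rw [← RL_scale α _ h1, mul_div_cancel_left₀ _ h1.ne']
  rfl

theorem AR_entry (p n : ℕ) (hp : 2 ≤ p) (hn : 0 < n) (α : ℝ) (i j : Fin (n + p - 2)) :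
    (n:ℝ) ^ (-α) * ARmat p n α i j = VV p n α (n + p - 1 - j) (n * greville p n (n + p - 1 - i)) := by
  have h1 : (0:ℝ) < n := by exact_mod_cast hn
  have hi := i.2
  have hj := j.2
  unfold VV
  rw [← RL_scale α _ h1, mul_div_cancel_left₀ _ h1.ne']
  congr 1
  simp only [ARmat, Matrix.of_apply]
  rw [RL_right, greville_symm p n (by omega) hn (i + 2) (n + p - 1 - i) (by omega)]
  rw [RL_congr_ae α (fun y => bspline p n p (j + 2) (1 - y)) (bspline p n p (n + p - 1 - j))]
  have : ∀ᵐ x : ℝ, ∀ l, x ≠ knot p n l := by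
    rw [ae_all_iff]
    intro l
    simp [ae_iff]
  filter_upwards [this] with x hx
  exact bspline_symm p n hn x hx p _ _ (by omega)


theorem toep_Vc {p : ℕ} (hp : 2 ≤ p) {α : ℝ} (h1 : 1 < α) (h2 : α < 2) (k : ℤ) :
    (fourierCoeffSym (fSymbol p α) k).re = 1 / (2 * Real.cos (Real.pi * α / 2)) *
      (Vc p α (k + (p + 1) / 2) + Vc p α (-k + (p + 1) / 2)) := by
  rw [toeplitz_coeff hp h1 h2, show (k:ℝ) - (p + 1) / 2 = (k + (p + 1) / 2) - (p + 1) by ring, Vc_sum,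
    show (p:ℝ) + 1 - (k + (p + 1) / 2) = -k + (p + 1) / 2 by ring]

theorem Vc_bound (p : ℕ) (hp : 2 ≤ p) {α : ℝ} (h1 : 1 < α) (h2 : α < 2) :
    ∃ C : ℝ, 0 ≤ C ∧ ∀ k : ℤ, |Vc p α (k + (p + 1) / 2)| ≤ C / (1 + |(k:ℝ)|) := by
  have hp0 : (0:ℝ) < p := by exact_mod_cast (by omega : 0 < p)
  obtain ⟨C, hC0, hC⟩ := VV_bound1 p hp h1
  refine ⟨C * (1 + (2 * p + 1)), by positivity, fun k => ?_⟩
  obtain ⟨r, hr⟩ := Nat.even_mul_succ_self p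
  have hr' : (p:ℝ) * (p + 1) = r + r := by exact_mod_cast hr
  have := hC (p+1) le_rfl (p+1) (by omega) (k * p + r)
  rw [VV_card p (p+1) hp (by omega) h2 (p+1) le_rfl le_rfl] at this
  have e : ((k * p + r : ℤ) : ℝ) / p = k + (p + 1) / 2 := by
    push_cast
    field_simp
    linear_combination -hr'
  rw [e] at this
  push_cast at this
  rw [sub_self, sub_zero] at this
  refine this.trans (dist_change hC0 (by positivity) ?_)
  rw [show (k:ℝ) + (p + 1) / 2 - (p + 1) - k = -((p + 1) / 2) by ring, abs_neg, abs_of_nonneg (by positivity)]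
  linarith

theorem Rmat_entry (p n : ℕ) (α : ℝ) (i j : Fin (n + p - 2)) :
    Rmat p n α i j = 1 / (2 * Real.cos (Real.pi * α / 2)) *
      ((n:ℝ) ^ (-α) * ALmat p n α i j + (n:ℝ) ^ (-α) * ARmat p n α i j) -
      (fourierCoeffSym (fSymbol p α) ((i : ℤ) - (j : ℤ))).re := by
  simp only [Rmat, Amat, toeplitzMat, Matrix.sub_apply, Matrix.smul_apply, Matrix.add_apply, Matrix.of_apply,
    smul_eq_mul]
  ring

theorem Rmat_zero (p n : ℕ) (hp : 2 ≤ p) (hn : 0 < n) {α : ℝ} (h1 : 1 < α) (h2 : α < 2) (i j : Fin (n + p - 2))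
    (hi : p ≤ (i:ℕ) + 2 ∧ (i:ℕ) + 2 ≤ n + 1) (hj : p + 1 ≤ (j:ℕ) + 2 ∧ (j:ℕ) + 2 ≤ n) : Rmat p n α i j = 0 := by
  have c1 : ((n + p - 1 - i : ℕ):ℝ) = n + p - 1 - (i:ℕ) := by
    rw [Nat.cast_sub (by omega), Nat.cast_sub (by omega)]; push_cast; ring
  have c2 : ((n + p - 1 - j : ℕ):ℝ) = n + p - 1 - (j:ℕ) := by
    rw [Nat.cast_sub (by omega), Nat.cast_sub (by omega)]; push_cast; ring
  rw [Rmat_entry, AL_entry p n hn, AR_entry p n hp hn, toep_Vc hp h1 h2,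
    VV_card p n hp hn h2 _ hj.1 hj.2, VV_card p n hp hn h2 _ (by omega) (by omega),
    grev_mid p n hp hn _ hi.1 hi.2, grev_mid p n hp hn _ (by omega) (by omega),
    c1, c2, ← mul_sub]
  push_cast
  rw [sub_eq_zero.mpr, mul_zero]
  congr 2 <;> ring

theorem Rmat_bound (p : ℕ) (hp : 2 ≤ p) {α : ℝ} (h1 : 1 < α) (h2 : α < 2) :
    ∃ K : ℝ, ∀ n, p + 1 ≤ n → ∀ i j : Fin (n + p - 2),
      |Rmat p n α i j| ≤ K / (1 + |(((i : ℤ) - (j : ℤ) : ℤ) : ℝ)|) := by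
  obtain ⟨C, hC0, hC⟩ := VV_entry p hp h1
  obtain ⟨D, hD0, hD⟩ := Vc_bound p hp h1 h2
  refine ⟨|1 / (2 * Real.cos (Real.pi * α / 2))| * (C + C + D + D), fun n hn i j => ?_⟩
  have hi := i.2
  have hj := j.2
  rw [Rmat_entry, AL_entry p n (by omega), AR_entry p n hp (by omega), toep_Vc hp h1 h2, ← mul_sub, abs_mul,
    mul_div_assoc |1 / (2 * Real.cos (Real.pi * α / 2))|]
  refine mul_le_mul_of_nonneg_left ?_ (abs_nonneg _)
  set k : ℤ := (i : ℤ) - (j : ℤ) with hk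
  have b1 := hC n hn (i + 2) (j + 2) (by omega) (by omega)
  have b2 := hC n hn (n + p - 1 - i) (n + p - 1 - j) (by omega) (by omega)
  have b3 := hD k
  have b4 := hD (-k)
  have hkr : (k:ℝ) = (i:ℕ) - (j:ℕ) := by rw [hk]; push_cast; rfl
  have q1 : |(((i:ℕ) + 2 : ℕ):ℝ) - (((j:ℕ) + 2 : ℕ):ℝ)| = |(k:ℝ)| := by
    rw [hkr]; push_cast; congr 1; ring
  have q2 : |((n + p - 1 - i : ℕ):ℝ) - ((n + p - 1 - j : ℕ):ℝ)| = |(k:ℝ)| := by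
    rw [Nat.cast_sub (by omega : (i:ℕ) ≤ n + p - 1), Nat.cast_sub (by omega : (j:ℕ) ≤ n + p - 1), hkr,
      abs_sub_comm]
    congr 1; ring
  rw [q1] at b1
  rw [q2] at b2
  push_cast at b4
  rw [abs_neg (k:ℝ)] at b4
  rw [add_div (C + C + D), add_div (C + C), add_div C]
  refine (abs_sub _ _).trans ?_
  refine (add_le_add (abs_add_le _ _) (abs_add_le _ _)).trans ?_
  linarith

theorem card_bad (N p m : ℕ) (S : Finset (Fin N)) (h : ∀ i ∈ S, (i:ℕ) < p ∨ (m ≤ (i:ℕ) ∧ (i:ℕ) < m + p)) :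
    S.card ≤ 2 * p := by
  rw [← Finset.card_map Fin.valEmbedding]
  have : S.map Fin.valEmbedding ⊆ Finset.range p ∪ Finset.Ico m (m + p) := by
    intro x hx
    simp only [Finset.mem_map, Fin.valEmbedding_apply] at hx
    obtain ⟨i, hi, rfl⟩ := hx
    have := h i hi
    simp only [Finset.mem_union, Finset.mem_range, Finset.mem_Ico]
    exact this
  refine (Finset.card_le_card this).trans ((Finset.card_union_le _ _).trans ?_)
  simp
  omega

theorem stmt16 (p : ℕ) (hp : 2 ≤ p) (α : ℝ) (h1 : 1 < α) (h2 : α < 2) :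
    ∃ C > (0 : ℝ), ∀ n : ℕ, 1 ≤ n →
      matNorm2 (Rmat p n α) ≤ C ∧ matTraceNorm (Rmat p n α) ≤ C := by
  obtain ⟨K, hK⟩ := Rmat_bound p hp h1 h2
  obtain ⟨C, hC⟩ := abstract_bound (2 * p) K
  set D := ∑ n ∈ Finset.range (p + 1), (|matNorm2 (Rmat p n α)| + |matTraceNorm (Rmat p n α)|) with hD
  have hD0 : 0 ≤ D := Finset.sum_nonneg fun _ _ => by positivity
  refine ⟨|C| + D + 1, by positivity, fun n hn => ?_⟩
  rcases lt_or_ge n (p + 1) with h | h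
  · have := Finset.single_le_sum (f := fun n => (|matNorm2 (Rmat p n α)| + |matTraceNorm (Rmat p n α)|))
      (fun _ _ => by positivity) (Finset.mem_range.mpr h)
    rw [← hD] at this
    have a1 := le_abs_self (matNorm2 (Rmat p n α))
    have a2 := le_abs_self (matTraceNorm (Rmat p n α))
    have a3 := abs_nonneg (matNorm2 (Rmat p n α))
    have a4 := abs_nonneg (matTraceNorm (Rmat p n α))
    have a5 := abs_nonneg C
    constructor <;> linarith
  · classical
    have := hC (n + p - 2) (Rmat p n α)
      (Finset.univ.filter fun i => ¬ (p ≤ (i:ℕ) + 2 ∧ (i:ℕ) + 2 ≤ n + 1))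
      (Finset.univ.filter fun j => ¬ (p + 1 ≤ (j:ℕ) + 2 ∧ (j:ℕ) + 2 ≤ n))
      (card_bad _ p n _ fun i hi => by
        have := i.2
        simp only [Finset.mem_filter, Finset.mem_univ, true_and] at hi
        omega)
      (card_bad _ p (n - 1) _ fun i hi => by
        have := i.2
        simp only [Finset.mem_filter, Finset.mem_univ, true_and] at hi
        omega)
      (fun i j hi hj => by
        simp only [Finset.mem_filter, Finset.mem_univ, true_and, not_not] at hi hj
        exact Rmat_zero p n hp (by omega) h1 h2 i j hi hj)
      (hK n h)
    have a5 := le_abs_self C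
    constructor <;> linarith [this.1, this.2]
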